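/- arXiv:1710.10725 — 2 statements merged into one kernel-verified Lean document; each statement's English description precedes it below -/
import Mathlib

section
/- In the periodic maximum-principle setting described below, assume that either (1) there exist an index i₀ ∈ {1,…,n} and a point p₀ ∈ ℝ^d∖P with f_{i₀}(p₀) < 0, or (2) P is nonempty. Then u_i(x) > 0 for every x ∈ ℝ^d∖P and every 1 ≤ i ≤ n. -/
open Filter

noncomputable def Lop {d : ℕ} (X : (Fin d → ℝ) → (Fin d → ℝ)) (φ : (Fin d → ℝ) → ℝ)
    (x : Fin d → ℝ) : ℝ :=
  (∑ k, fderiv ℝ (fun y => fderiv ℝ φ y (Pi.single k 1)) x (Pi.single k 1)) +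
      (∑ k, X x k * fderiv ℝ φ x (Pi.single k 1))

theorem dd_contDiffAt {d : ℕ} {φ : (Fin d → ℝ) → ℝ} {x : Fin d → ℝ}
    (h : ContDiffAt ℝ 2 φ x) (e : Fin d → ℝ) :
    ContDiffAt ℝ 1 (fun y => fderiv ℝ φ y e) x := by
  have h1 : ContDiffAt ℝ 1 (fderiv ℝ φ) x := h.fderiv_right (by norm_num)
  exact h1.clm_apply contDiffAt_const

theorem Lop_congr {d : ℕ} {X : (Fin d → ℝ) → (Fin d → ℝ)} {φ ψ : (Fin d → ℝ) → ℝ}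
    {x : Fin d → ℝ} (h : φ =ᶠ[nhds x] ψ) : Lop X φ x = Lop X ψ x := by
  unfold Lop
  have h1 := h.fderiv (𝕜 := ℝ)
  congr 1
  · refine Finset.sum_congr rfl fun k _ => ?_
    have : (fun y => fderiv ℝ φ y (Pi.single k 1)) =ᶠ[nhds x]
        (fun y => fderiv ℝ ψ y (Pi.single k 1)) := by
      filter_upwards [h1] with y hy
      rw [hy]
    rw [this.fderiv_eq]
  · rw [h1.eq_of_nhds]

theorem Lop_add {d : ℕ} {X : (Fin d → ℝ) → (Fin d → ℝ)} {φ ψ : (Fin d → ℝ) → ℝ}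
    {x : Fin d → ℝ} (h : ContDiffAt ℝ 2 φ x) (h' : ContDiffAt ℝ 2 ψ x) :
    Lop X (fun y => φ y + ψ y) x = Lop X φ x + Lop X ψ x := by
  unfold Lop
  have e1 : ∀ᶠ y in nhds x, ContDiffAt ℝ 2 φ y := h.eventually (by simp)
  have e2 : ∀ᶠ y in nhds x, ContDiffAt ℝ 2 ψ y := h'.eventually (by simp)
  have h1 : ∀ᶠ y in nhds x, fderiv ℝ (fun y => φ y + ψ y) y = fderiv ℝ φ y + fderiv ℝ ψ y := by
    filter_upwards [e1, e2] with y a b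
    exact fderiv_fun_add (a.differentiableAt (by norm_num)) (b.differentiableAt (by norm_num))
  have h2 : ∀ k : Fin d, fderiv ℝ (fun y => fderiv ℝ (fun y => φ y + ψ y) y (Pi.single k 1)) x
      = fderiv ℝ (fun y => fderiv ℝ φ y (Pi.single k 1)) x
       + fderiv ℝ (fun y => fderiv ℝ ψ y (Pi.single k 1)) x := by
    intro k
    rw [← fderiv_fun_add ((dd_contDiffAt h _).differentiableAt (by norm_num))
      ((dd_contDiffAt h' _).differentiableAt (by norm_num))]
    apply Filter.EventuallyEq.fderiv_eq
    filter_upwards [h1] with y hy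
    rw [hy]; rfl
  simp only [h2, h1.self_of_nhds, add_apply, mul_add, Finset.sum_add_distrib]
  ring

theorem Lop_smul {d : ℕ} {X : (Fin d → ℝ) → (Fin d → ℝ)} {φ : (Fin d → ℝ) → ℝ}
    {x : Fin d → ℝ} (a : ℝ) :
    Lop X (fun y => a * φ y) x = a * Lop X φ x := by
  unfold Lop
  have h1 : ∀ y, fderiv ℝ (fun y => a * φ y) y = a • fderiv ℝ φ y := by
    intro y
    exact congrFun (fderiv_const_smul_field (𝕜 := ℝ) (f := φ) a) y
  simp only [h1, smul_apply, mul_add, Finset.mul_sum]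
  congr 1
  · refine Finset.sum_congr rfl fun k _ => ?_
    have : fderiv ℝ (fun y => a • fderiv ℝ φ y (Pi.single k 1)) x =
      a • fderiv ℝ (fun y => fderiv ℝ φ y (Pi.single k 1)) x :=
      congrFun (fderiv_const_smul_field (𝕜 := ℝ) (f := fun y => fderiv ℝ φ y (Pi.single k 1)) a) x
    rw [this]; simp
  · refine Finset.sum_congr rfl fun k _ => ?_
    simp; ring

theorem Lop_const {d : ℕ} {X : (Fin d → ℝ) → (Fin d → ℝ)} {x : Fin d → ℝ} (a : ℝ) :
    Lop X (fun _ => a) x = 0 := by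
  simp [Lop]

theorem Lop_sum {d : ℕ} {ι : Type*} {X : (Fin d → ℝ) → (Fin d → ℝ)} {u : ι → (Fin d → ℝ) → ℝ}
    {x : Fin d → ℝ} (S : Finset ι) (h : ∀ i ∈ S, ContDiffAt ℝ 2 (u i) x) :
    Lop X (fun y => ∑ i ∈ S, u i y) x = ∑ i ∈ S, Lop X (u i) x := by
  classical
  induction S using Finset.induction_on with
  | empty => simp [Lop_const]
  | insert a S ha ih =>
    simp only [Finset.sum_insert ha]
    rw [Lop_add (h a (by simp)) (ContDiffAt.sum fun i hi => h i (by simp [hi])),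
      ih fun i hi => h i (by simp [hi])]

theorem Lop_continuousAt {d : ℕ} {X : (Fin d → ℝ) → (Fin d → ℝ)} (hX : Continuous X)
    {φ : (Fin d → ℝ) → ℝ} {x : Fin d → ℝ} (h : ContDiffAt ℝ 2 φ x) :
    ContinuousAt (Lop X φ) x := by
  unfold Lop
  apply ContinuousAt.add
  · refine tendsto_finsetSum _ fun k _ => ?_
    have h1 : ContDiffAt ℝ 0 (fderiv ℝ (fun y => fderiv ℝ φ y (Pi.single k 1))) x :=
      (dd_contDiffAt h _).fderiv_right (by norm_num)
    exact h1.continuousAt.clm_apply continuousAt_const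
  · refine tendsto_finsetSum _ fun k _ => ?_
    exact ((continuous_apply k).comp hX).continuousAt.mul (dd_contDiffAt h _).continuousAt

theorem Lop_localMax {d : ℕ} {X : (Fin d → ℝ) → (Fin d → ℝ)}
    {φ : (Fin d → ℝ) → ℝ} {x : Fin d → ℝ} (h : ContDiffAt ℝ 2 φ x) (hm : IsLocalMax φ x) :
    Lop X φ x ≤ 0 := by
  unfold Lop
  rw [hm.fderiv_eq_zero]
  simp only [zero_apply, mul_zero, Finset.sum_const_zero, add_zero]
  refine Finset.sum_nonpos fun k _ => ?_
  set e : Fin d → ℝ := Pi.single k 1 with he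
  set g : ℝ → ℝ := fun t => φ (x + t • e) with hg
  have hl : ∀ t : ℝ, HasDerivAt (fun t : ℝ => x + t • e) e t := by
    intro t
    simpa using ((hasDerivAt_id t).smul_const e).const_add x
  have hlc : Tendsto (fun t : ℝ => x + t • e) (nhds 0) (nhds x) := by
    have := (hl 0).continuousAt.tendsto
    simpa using this
  have e1 : ∀ᶠ y in nhds x, ContDiffAt ℝ 2 φ y := h.eventually (by simp)
  have hd1 : ∀ᶠ t in nhds (0:ℝ), HasDerivAt g (fderiv ℝ φ (x + t • e) e) t := by
    filter_upwards [hlc.eventually e1] with t ht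
    exact (ht.differentiableAt (by norm_num)).hasFDerivAt.comp_hasDerivAt t (hl t)
  have hd1' : deriv g =ᶠ[nhds 0] fun t => fderiv ℝ φ (x + t • e) e := by
    filter_upwards [hd1] with t ht using ht.deriv
  have hd2 : deriv (deriv g) 0 = fderiv ℝ (fun y => fderiv ℝ φ y e) x e := by
    rw [hd1'.deriv_eq]
    apply HasDerivAt.deriv
    have h2 := ((dd_contDiffAt h e).differentiableAt (by norm_num)).hasFDerivAt
    have h2' : HasFDerivAt (fun y => fderiv ℝ φ y e) (fderiv ℝ (fun y => fderiv ℝ φ y e) x)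
      (x + (0:ℝ) • e) := by simpa using h2
    exact h2'.comp_hasDerivAt 0 (hl 0)
  rw [← hd2]
  by_contra! hpos
  have hgm : IsLocalMax g 0 := by
    have : ∀ᶠ t in nhds (0:ℝ), φ (x + t • e) ≤ φ x := hlc.eventually hm
    filter_upwards [this] with t ht
    simpa [hg] using ht
  have hmin := isLocalMin_of_deriv_deriv_pos hpos hgm.deriv_eq_zero hd1.self_of_nhds.continuousAt
  have hc : g =ᶠ[nhds 0] fun _ => g 0 := by
    filter_upwards [hgm, hmin] with t a b using le_antisymm a b
  have : deriv g =ᶠ[nhds 0] fun _ => 0 := by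
    have := hc.deriv
    simpa using this
  rw [this.deriv_eq] at hpos
  simp at hpos

def Visc {d : ℕ} (X : (Fin d → ℝ) → (Fin d → ℝ)) (M : ℝ) (w : (Fin d → ℝ) → ℝ) : Prop :=
  ∀ x φ, ContDiff ℝ 2 φ → IsLocalMin (fun y => w y - φ y) x → Lop X φ x ≤ M * w x

theorem barrier {d : ℕ} (X : (Fin d → ℝ) → (Fin d → ℝ)) (y : Fin d → ℝ) (α b : ℝ)
    (x : Fin d → ℝ) :
    Lop X (fun x => Real.exp (-α * ∑ k, (x k - y k)^2) - b) x =
      Real.exp (-α * ∑ k, (x k - y k)^2) *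
       (4 * α^2 * (∑ k, (x k - y k)^2) - 2 * α * d - 2 * α * ∑ k, X x k * (x k - y k)) := by
  have hq : ∀ x : Fin d → ℝ, HasFDerivAt (fun x : Fin d → ℝ => ∑ k, (x k - y k)^2)
      (∑ k, (2 * (x k - y k)) • ContinuousLinearMap.proj (R := ℝ) (φ := fun _ : Fin d => ℝ) k) x := by
    intro x
    apply HasFDerivAt.fun_sum
    intro k _
    have := ((hasFDerivAt_apply (𝕜 := ℝ) k x).sub_const (y k)).pow 2
    simpa using this
  have hE := fun x => ((hq x).const_mul (-α)).exp
  have h1 : ∀ x k, fderiv ℝ (fun x => Real.exp (-α * ∑ k, (x k - y k)^2) - b) x (Pi.single k 1)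
     = Real.exp (-α * ∑ k, (x k - y k)^2) * (-2 * α * (x k - y k)) := by
    intro x k
    rw [((hE x).sub_const b).fderiv]
    simp [Pi.single_apply]
    ring
  unfold Lop
  simp only [h1]
  have h2 : ∀ k, fderiv ℝ (fun x : Fin d → ℝ => Real.exp (-α * ∑ k, (x k - y k)^2) *
      (-2 * α * (x k - y k))) x (Pi.single k 1) =
      Real.exp (-α * ∑ k, (x k - y k)^2) * (4 * α^2 * (x k - y k)^2 - 2 * α) := by
    intro k
    have := (hE x).fun_mul (((hasFDerivAt_apply (𝕜 := ℝ) k x).sub_const (y k)).const_mul (-2 * α))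
    rw [this.fderiv]
    simp [Pi.single_apply]
    ring
  simp only [h2]
  generalize Real.exp (-α * ∑ k, (x k - y k)^2) = E
  have a1 : ∑ k, E * (4 * α^2 * (x k - y k)^2 - 2 * α) =
      E * (4 * α^2 * (∑ k, (x k - y k)^2) - 2 * α * d) := by
    rw [← Finset.mul_sum, Finset.sum_sub_distrib, ← Finset.mul_sum, Finset.sum_const,
      Finset.card_univ, Fintype.card_fin, nsmul_eq_mul]
    ring
  have a2 : ∑ k, X x k * (E * (-2 * α * (x k - y k))) =
      E * (-2 * α * ∑ k, X x k * (x k - y k)) := by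
    rw [Finset.mul_sum, Finset.mul_sum]
    refine Finset.sum_congr rfl fun k _ => ?_
    ring
  rw [a1, a2]
  ring

theorem visc_smp {d : ℕ} {X : (Fin d → ℝ) → (Fin d → ℝ)} (hX : Continuous X) {M : ℝ} (hM : 0 ≤ M)
    {w : (Fin d → ℝ) → ℝ} (hw : Continuous w) (hw0 : ∀ x, 0 ≤ w x) (hv : Visc X M w)
    {z : Fin d → ℝ} (hz : w z = 0) (y : Fin d → ℝ) : w y = 0 := by
  by_contra hy
  set q : (Fin d → ℝ) → ℝ := fun x => ∑ k, (x k - y k)^2 with hq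
  have hqc : Continuous q := by fun_prop
  have hcpt : ∀ R, IsCompact {x | q x ≤ R} := by
    intro R
    refine Metric.isCompact_of_isClosed_isBounded (isClosed_le hqc continuous_const) ?_
    rw [Metric.isBounded_iff_subset_closedBall y]
    refine ⟨|R| + 1, fun x hx => ?_⟩
    rw [Metric.mem_closedBall, dist_pi_le_iff (by positivity)]
    intro k
    have h1 : (x k - y k)^2 ≤ q x := Finset.single_le_sum (f := fun k => (x k - y k)^2)
      (fun i _ => sq_nonneg _) (Finset.mem_univ k)
    have h2 : q x ≤ R := hx
    rw [Real.dist_eq]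
    have := le_abs_self R
    have h3 := sq_abs (x k - y k)
    nlinarith [abs_nonneg (x k - y k), abs_nonneg R]
  obtain ⟨x0, ⟨hx0z, hx0q⟩, hx0m⟩ := ((hcpt (q z)).inter_left
    (isClosed_eq hw continuous_const)).exists_isMinOn (f := q) ⟨z, hz, le_refl (q z)⟩ hqc.continuousOn
  have hx0z : w x0 = 0 := hx0z
  have hmin : ∀ x, w x = 0 → q x0 ≤ q x := by
    intro x hx
    rcases le_total (q x) (q z) with h | h
    · exact hx0m ⟨hx, h⟩
    · exact le_trans hx0q h
  set r := q x0 with hr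
  have hrpos : 0 < r := by
    have h0 : 0 ≤ r := Finset.sum_nonneg fun i _ => sq_nonneg _
    rcases h0.lt_or_eq with h | h
    · exact h
    exfalso
    have : x0 = y := by
      funext k
      have := (Finset.sum_eq_zero_iff_of_nonneg (fun i _ => sq_nonneg (x0 i - y i))).1 h.symm k
        (Finset.mem_univ k)
      have := pow_eq_zero_iff (two_ne_zero) |>.1 this
      linarith
    exact hy (this ▸ hx0z)
  -- bound on drift
  obtain ⟨B, hB⟩ := (hcpt (4 * r)).bddAbove_image (f := fun x => ∑ k, X x k * (x k - y k))
    (by fun_prop)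
  have hB' : ∀ x, q x ≤ 4 * r → ∑ k, X x k * (x k - y k) ≤ |B| := fun x hx =>
    (hB ⟨x, hx, rfl⟩).trans (le_abs_self B)
  obtain ⟨α, hα1, hα⟩ : ∃ α : ℝ, 1 ≤ α ∧ 2 * d + 2 * |B| + M < α * r := by
    refine ⟨(2 * d + 2 * |B| + M) / r + 1, ?_, ?_⟩
    · have : 0 ≤ (2 * d + 2 * |B| + M) / r := by positivity
      linarith
    · rw [add_mul, div_mul_cancel₀ _ hrpos.ne']; linarith
  set b := Real.exp (-α * r) with hb
  set h : (Fin d → ℝ) → ℝ := fun x => Real.exp (-α * ∑ k, (x k - y k)^2) - b with hh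
  have hhs : ContDiff ℝ 2 h := by
    apply ContDiff.sub _ contDiff_const
    apply ContDiff.exp
    apply ContDiff.mul contDiff_const
    apply ContDiff.sum
    intro k _
    exact ((contDiff_apply ℝ ℝ k).sub contDiff_const).pow 2
  -- inner lower bound
  obtain ⟨δ, hδ, hδw⟩ : ∃ δ > 0, ∀ x, q x ≤ r / 4 → δ ≤ w x := by
    obtain ⟨x2, hx2, hm2⟩ := (hcpt (r/4)).exists_isMinOn (f := w)
      ⟨y, by simp [hq]; positivity⟩ hw.continuousOn
    refine ⟨w x2, ?_, fun x hx => hm2 hx⟩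
    refine lt_of_le_of_ne (hw0 _) fun h => ?_
    have := hmin x2 h.symm
    have : q x2 ≤ r / 4 := hx2
    linarith
  have hKc : IsCompact ({x | r / 4 ≤ q x} ∩ {x | q x ≤ 4 * r}) :=
    (hcpt (4*r)).inter_left (isClosed_le continuous_const hqc)
  obtain ⟨x1, ⟨hx1a, hx1b⟩, hx1m⟩ := hKc.exists_isMinOn (f := fun x => w x - δ * h x)
    ⟨x0, by constructor <;> simp only [Set.mem_ofPred_eq, ← hr] <;> linarith⟩
    (by have := hhs.continuous; fun_prop)
  have hhx0 : h x0 = 0 := by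
    show Real.exp (-α * q x0) - b = 0
    simp [hb, ← hr]
  have hg1 : w x1 - δ * h x1 ≤ 0 := by
    have : w x1 - δ * h x1 ≤ w x0 - δ * h x0 :=
      hx1m ⟨by simp only [Set.mem_ofPred_eq, ← hr]; linarith, by simp only [Set.mem_ofPred_eq, ← hr]; linarith⟩
    simpa [hx0z, hhx0] using this
  have hx1q : q x1 ≤ r := by
    by_contra! hlt
    have : h x1 < 0 := by
      show Real.exp (-α * q x1) - b < 0
      rw [sub_neg, hb, Real.exp_lt_exp]
      nlinarith
    have := hw0 x1
    nlinarith
  have hx1l : r / 4 < q x1 := by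
    by_contra! hle
    have h1 := hδw x1 hle
    have : h x1 < 1 := by
      show Real.exp (-α * q x1) - b < 1
      have : Real.exp (-α * q x1) ≤ 1 := by
        rw [Real.exp_le_one_iff]
        have : 0 ≤ q x1 := Finset.sum_nonneg fun i _ => sq_nonneg _
        nlinarith
      have : 0 < b := Real.exp_pos _
      linarith
    nlinarith
  have hloc : IsLocalMin (fun x => w x - δ * h x) x1 := by
    apply hx1m.isLocalMin
    apply inter_mem
    · filter_upwards [hqc.continuousAt.eventually (lt_mem_nhds hx1l)] with x hx using le_of_lt hx
    · filter_upwards [hqc.continuousAt.eventually (gt_mem_nhds (show q x1 < 4 * r by linarith))]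
        with x hx using le_of_lt hx
  have key := hv x1 (fun x => δ * h x) (contDiff_const.mul hhs) hloc
  rw [Lop_smul, barrier] at key
  change δ * (Real.exp (-α * q x1) * (4 * α^2 * q x1 - 2 * α * d - 2 * α * ∑ k, X x1 k * (x1 k - y k)))
    ≤ M * w x1 at key
  set E := Real.exp (-α * q x1) with hE
  have hEpos : 0 < E := Real.exp_pos _
  have hhE : h x1 ≤ E := by
    show E - b ≤ E
    have : 0 < b := Real.exp_pos _
    linarith
  have hk2 : M * w x1 ≤ δ * (E * M) := by
    have : w x1 ≤ δ * E := by nlinarith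
    nlinarith
  have hk3 : 4 * α^2 * q x1 - 2 * α * d - 2 * α * ∑ k, X x1 k * (x1 k - y k) ≤ M := by
    have := key.trans hk2
    have := le_of_mul_le_mul_left this hδ
    exact le_of_mul_le_mul_left this hEpos
  have hBx := hB' x1 hx1b
  have i1 : α^2 * r ≤ 4 * α^2 * q x1 := by nlinarith
  have i2 : α * (2 * d + 2 * |B| + M) < α * (α * r) := by
    apply mul_lt_mul_of_pos_left hα; linarith
  have i3 : 2 * α * ∑ k, X x1 k * (x1 k - y k) ≤ 2 * α * |B| :=
    mul_le_mul_of_nonneg_left hBx (by linarith)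
  have i4 : M ≤ α * M := by nlinarith
  nlinarith

theorem glue_cont {d : ℕ} {Q : Set (Fin d → ℝ)} (hQ : IsClosed Q) {v : (Fin d → ℝ) → ℝ}
    (hv : ContinuousOn v Qᶜ) (hinf : ∀ p ∈ Q, Tendsto v (nhdsWithin p Qᶜ) atTop)
    {g : ℝ → ℝ} (hg : Continuous g) {a : ℝ} (ha : ∀ t, 1 ≤ t → g t = a)
    {w : (Fin d → ℝ) → ℝ} (h1 : ∀ x ∈ Q, w x = a) (h2 : ∀ x ∉ Q, w x = g (v x)) :
    Continuous w := by
  rw [continuous_iff_continuousAt]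
  intro x
  by_cases hx : x ∈ Q
  · have h3 := (hinf x hx).eventually_ge_atTop 1
    rw [eventually_nhdsWithin_iff] at h3
    have h4 : w =ᶠ[nhds x] fun _ => a := by
      filter_upwards [h3] with y hy
      by_cases hyQ : y ∈ Q
      · exact h1 y hyQ
      · rw [h2 y hyQ, ha _ (hy hyQ)]
    exact continuousAt_const.congr h4.symm
  · have h4 : w =ᶠ[nhds x] fun y => g (v y) := by
      filter_upwards [hQ.isOpen_compl.mem_nhds hx] with y hy using h2 y hy
    refine ContinuousAt.congr ?_ h4.symm
    exact hg.continuousAt.comp (hv.continuousAt (hQ.isOpen_compl.mem_nhds hx))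

theorem exists_shift {d : ℕ} (x : Fin d → ℝ) :
    ∀ j, 0 ≤ (x + fun j => ((-⌊x j⌋ : ℤ) : ℝ)) j ∧ (x + fun j => ((-⌊x j⌋ : ℤ) : ℝ)) j < 1 := by
  intro j
  have := Int.floor_le (x j)
  have := Int.lt_floor_add_one (x j)
  simp only [Pi.add_apply, Int.cast_neg]
  constructor <;> linarith

theorem poles_countable {d : ℕ} {Q : Set (Fin d → ℝ)}
    (hinv : ∀ x ∈ Q, ∀ v : Fin d → ℤ, (x + fun j => (v j : ℝ)) ∈ Q)
    (hfin : (Q ∩ {x | ∀ j, 0 ≤ x j ∧ x j < 1}).Finite) : Q.Countable := by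
  refine Set.Countable.mono ?_ (Set.Countable.image2 hfin.countable
    (Set.countable_univ (α := Fin d → ℤ)) (fun x v => x + fun j => (v j : ℝ)))
  intro x hx
  refine ⟨_, ⟨hinv x hx fun j => -⌊x j⌋, exists_shift x⟩, fun j => ⌊x j⌋, Set.mem_univ _, ?_⟩
  funext j
  simp

theorem poles_closed {d : ℕ} {Q : Set (Fin d → ℝ)}
    (hinv : ∀ x ∈ Q, ∀ v : Fin d → ℤ, (x + fun j => (v j : ℝ)) ∈ Q)
    (hfin : (Q ∩ {x | ∀ j, 0 ≤ x j ∧ x j < 1}).Finite) : IsClosed Q := by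
  have hf : ∀ z, (Q ∩ Metric.closedBall z 1).Finite := by
    intro z
    refine Set.Finite.subset (Set.Finite.image2 (fun x v => x + fun j => ((v j : ℤ) : ℝ)) hfin
      (Set.finite_Icc (fun j => ⌊z j - 1⌋) (fun j => ⌊z j + 1⌋))) ?_
    rintro x ⟨hx, hxz⟩
    refine ⟨_, ⟨hinv x hx fun j => -⌊x j⌋, exists_shift x⟩, fun j => ⌊x j⌋, ?_, ?_⟩
    · rw [Metric.mem_closedBall, dist_pi_le_iff (by norm_num)] at hxz
      constructor
      · intro j
        have := abs_le.1 (Real.dist_eq _ _ ▸ hxz j)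
        exact Int.floor_le_floor (by linarith)
      · intro j
        have := abs_le.1 (Real.dist_eq _ _ ▸ hxz j)
        exact Int.floor_le_floor (by linarith)
    · funext j
      simp
  rw [← isOpen_compl_iff, isOpen_iff_mem_nhds]
  intro z hz
  have h1 : (Q ∩ Metric.closedBall z 1)ᶜ ∈ nhds z :=
    (hf z).isClosed.isOpen_compl.mem_nhds fun h => hz h.1
  filter_upwards [h1, Metric.closedBall_mem_nhds z one_pos] with y hy hy2 hyQ
  exact hy ⟨hyQ, hy2⟩

/-- periodic maximum principle for cooperative, column diagonally dominant,
fully coupled elliptic systems on the flat torus `ℝ^d/ℤ^d`: if either some `f_{i₀}(p₀) < 0`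
at some point `p₀ ∉ P`, or the pole set `P` is nonempty, then `u_i > 0` on `ℝ^d∖P`. -/
theorem stmt4 (d n : ℕ) (hd : 1 ≤ d) (hn : 1 ≤ n)
    (P : Fin n → Set (Fin d → ℝ))
    (hPinv : ∀ i, ∀ x ∈ P i, ∀ v : Fin d → ℤ, (x + fun j => (v j : ℝ)) ∈ P i)
    (hPfin : ∀ i, ((P i) ∩ {x | ∀ j, 0 ≤ x j ∧ x j < 1}).Finite)
    (u : Fin n → (Fin d → ℝ) → ℝ)
    (hu_smooth : ∀ i, ContDiffOn ℝ 2 (u i) (P i)ᶜ)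
    (hu_per : ∀ i x (v : Fin d → ℤ), u i (x + fun j => (v j : ℝ)) = u i x)
    (hu_inf : ∀ i, ∀ p ∈ P i, Tendsto (u i) (nhdsWithin p (P i)ᶜ) atTop)
    (c : Fin n → Fin n → (Fin d → ℝ) → ℝ)
    (hc_cont : ∀ i j, ContinuousOn (c i j) (⋃ k, P k)ᶜ)
    (hc_bdd : ∀ i j, ∃ M : ℝ, ∀ x ∈ (⋃ k, P k)ᶜ, |c i j x| ≤ M)
    (hc_per : ∀ i j x (v : Fin d → ℤ), c i j (x + fun k => (v k : ℝ)) = c i j x)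
    (h_coop : ∀ i j, i ≠ j → ∀ x ∈ (⋃ k, P k)ᶜ, 0 ≤ c i j x)
    (h_cdd : ∀ j, ∀ x ∈ (⋃ k, P k)ᶜ, ∑ i, c i j x ≤ 0)
    (h_coupled : ∀ α β : Finset (Fin n), α.Nonempty → β.Nonempty → Disjoint α β →
      α ∪ β = Finset.univ →
      ∃ i ∈ α, ∃ j ∈ β, ∃ x ∈ (⋃ k, P k)ᶜ, c i j x ≠ 0)
    (X : (Fin d → ℝ) → (Fin d → ℝ))
    (hX_cont : Continuous X)
    (hX_per : ∀ x (v : Fin d → ℤ), X (x + fun k => (v k : ℝ)) = X x)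
    (f : Fin n → (Fin d → ℝ) → ℝ)
    (hf_cont : ∀ i, ContinuousOn (f i) (⋃ k, P k)ᶜ)
    (hf_nonpos : ∀ i, ∀ x ∈ (⋃ k, P k)ᶜ, f i x ≤ 0)
    (hf_per : ∀ i x (v : Fin d → ℤ), f i (x + fun k => (v k : ℝ)) = f i x)
    (hPDE : ∀ i, ∀ x ∈ (⋃ k, P k)ᶜ,
      (∑ k, fderiv ℝ (fun y => fderiv ℝ (u i) y (Pi.single k 1)) x (Pi.single k 1)) +
      (∑ k, X x k * fderiv ℝ (u i) x (Pi.single k 1)) +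
      (∑ j, c i j x * u j x) = f i x)
    (hcond : (∃ i₀ : Fin n, ∃ p₀ ∈ (⋃ k, P k)ᶜ, f i₀ p₀ < 0) ∨ (⋃ k, P k).Nonempty) :
    ∀ x ∈ (⋃ k, P k)ᶜ, ∀ i, 0 < u i x := by
  classical
  have hcl : ∀ i, IsClosed (P i) := fun i => poles_closed (hPinv i) (hPfin i)
  have hdense : Dense (⋃ k, P k)ᶜ := by
    have : Nonempty (Fin d) := ⟨⟨0, hd⟩⟩
    exact Set.Countable.dense_compl ℝ
      (Set.countable_iUnion fun i => poles_countable (hPinv i) (hPfin i))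
  have hnb : ∀ x, (nhdsWithin x (⋃ k, P k)ᶜ).NeBot := fun x =>
    mem_closure_iff_nhdsWithin_neBot.1 (hdense x)
  have hnP : ∀ {x}, x ∈ (⋃ k, P k)ᶜ → ∀ k, x ∉ P k := fun hx k hk =>
    hx (Set.mem_iUnion.2 ⟨k, hk⟩)
  have hsm : ∀ i x, x ∉ P i → ContDiffAt ℝ 2 (u i) x := fun i x hx =>
    (hu_smooth i).contDiffAt ((hcl i).isOpen_compl.mem_nhds hx)
  have hPDE' : ∀ i, ∀ x ∈ (⋃ k, P k)ᶜ, Lop X (u i) x + ∑ j, c i j x * u j x = f i x := hPDE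
  obtain ⟨C, hC0, hC⟩ : ∃ C : ℝ, 0 ≤ C ∧ ∀ i j, ∀ x ∈ (⋃ k, P k)ᶜ, |c i j x| ≤ C := by
    choose M hM using hc_bdd
    refine ⟨∑ i, ∑ j, |M i j|, by positivity, fun i j x hx => ?_⟩
    refine (hM i j x hx).trans ((le_abs_self _).trans ?_)
    refine le_trans ?_ (Finset.single_le_sum (f := fun i => ∑ j, |M i j|)
      (fun i _ => by positivity) (Finset.mem_univ i))
    exact Finset.single_le_sum (f := fun j => |M i j|)
      (fun i _ => by positivity) (Finset.mem_univ j)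
  set K : ℝ := n * C with hK
  have hK0 : 0 ≤ K := by positivity
  set w : Fin n → (Fin d → ℝ) → ℝ := fun j x => if x ∈ P j then 0 else max (-u j x) 0 with hw
  have hwP : ∀ j x, x ∈ P j → w j x = 0 := fun j x hx => by simp [hw, hx]
  have hwN : ∀ j x, x ∉ P j → w j x = max (-u j x) 0 := fun j x hx => by simp [hw, hx]
  have hw0 : ∀ j x, 0 ≤ w j x := by
    intro j x
    by_cases hx : x ∈ P j
    · rw [hwP j x hx]
    · rw [hwN j x hx]; exact le_max_right _ _
  have hwu : ∀ j x, x ∉ P j → -u j x ≤ w j x := by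
    intro j x hx
    rw [hwN j x hx]; exact le_max_left _ _
  have hwpos : ∀ j x, 0 < w j x → x ∉ P j ∧ w j x = -u j x := by
    intro j x h
    by_cases hx : x ∈ P j
    · rw [hwP j x hx] at h; exact absurd h (lt_irrefl _)
    · refine ⟨hx, ?_⟩
      rw [hwN j x hx] at h ⊢
      rcases lt_max_iff.1 h with h | h
      · exact max_eq_left h.le
      · exact absurd h (lt_irrefl _)
  have hwc : ∀ j, Continuous (w j) := by
    intro j
    refine glue_cont (hcl j) (hu_smooth j).continuousOn (hu_inf j) (g := fun t => max (-t) 0)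
      (by fun_prop) (a := 0) (fun t ht => max_eq_right (by linarith)) (hwP j) (hwN j)
  have hPiff : ∀ j x (v : Fin d → ℤ), (x + fun k => (v k : ℝ)) ∈ P j ↔ x ∈ P j := by
    intro j x v
    refine ⟨fun h => ?_, fun h => hPinv j x h v⟩
    have := hPinv j _ h (fun k => - v k)
    convert this using 1
    funext k
    simp
  have hwper : ∀ j x (v : Fin d → ℤ), w j (x + fun k => (v k : ℝ)) = w j x := by
    intro j x v
    simp only [hw, hPiff, hu_per]
  -- pointwise inequality
  have pw : ∀ (S : Finset (Fin n)) (y), y ∈ (⋃ k, P k)ᶜ → (∀ k ∈ S, u k y ≤ 0) →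
      ∑ k ∈ S, Lop X (u k) y ≤ ∑ k ∈ S, f k y + ∑ j ∈ S, (∑ k ∈ Sᶜ, c k j y) * u j y
        + K * ∑ j ∈ Sᶜ, w j y := by
    intro S y hy hS
    have e1 : ∑ k ∈ S, Lop X (u k) y =
        ∑ k ∈ S, f k y - ∑ j, (∑ k ∈ S, c k j y) * u j y := by
      simp only [Finset.sum_mul]
      rw [Finset.sum_comm, ← Finset.sum_sub_distrib]
      refine Finset.sum_congr rfl fun k _ => ?_
      linarith [hPDE' k y hy]
    rw [e1, ← Finset.sum_add_sum_compl S]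
    have e2 : ∑ j ∈ S, -((∑ k ∈ S, c k j y) * u j y) ≤ ∑ j ∈ S, (∑ k ∈ Sᶜ, c k j y) * u j y := by
      refine Finset.sum_le_sum fun j hj => ?_
      have h1 := h_cdd j y hy
      rw [← Finset.sum_add_sum_compl S] at h1
      nlinarith [hS j hj]
    have e3 : ∑ j ∈ Sᶜ, -((∑ k ∈ S, c k j y) * u j y) ≤ K * ∑ j ∈ Sᶜ, w j y := by
      rw [Finset.mul_sum]
      refine Finset.sum_le_sum fun j hj => ?_
      have hj' : j ∉ S := Finset.mem_compl.1 hj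
      have h0 : 0 ≤ ∑ k ∈ S, c k j y := Finset.sum_nonneg fun k hk =>
        h_coop k j (fun h => hj' (h ▸ hk)) y hy
      have h1 : ∑ k ∈ S, c k j y ≤ K := by
        calc ∑ k ∈ S, c k j y ≤ ∑ k ∈ S, C :=
              Finset.sum_le_sum fun k _ => (le_abs_self _).trans (hC k j y hy)
          _ = S.card * C := by simp
          _ ≤ n * C := by
            apply mul_le_mul_of_nonneg_right _ hC0
            have := Finset.card_le_univ S
            rw [Fintype.card_fin] at this
            exact_mod_cast this
      have h2 := hwu j y (hnP hy j)
      have h3 := hw0 j y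
      nlinarith
    rw [Finset.sum_neg_distrib] at e2 e3
    linarith
  have lemA : ∀ (S : Finset (Fin n)) (x), (∀ k ∈ S, 0 < w k x) →
      ∑ k ∈ S, Lop X (u k) x ≤ K * ∑ j ∈ Sᶜ, w j x := by
    intro S x hS
    have := hnb x
    have t1 : Tendsto (fun y => ∑ k ∈ S, Lop X (u k) y) (nhdsWithin x (⋃ k, P k)ᶜ)
        (nhds (∑ k ∈ S, Lop X (u k) x)) := by
      refine tendsto_finsetSum _ fun k hk => ?_
      exact (Lop_continuousAt hX_cont (hsm k x (hwpos k x (hS k hk)).1)).tendsto.mono_left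
        nhdsWithin_le_nhds
    have t2 : Tendsto (fun y => K * ∑ j ∈ Sᶜ, w j y) (nhdsWithin x (⋃ k, P k)ᶜ)
        (nhds (K * ∑ j ∈ Sᶜ, w j x)) := by
      have : Continuous (fun y => K * ∑ j ∈ Sᶜ, w j y) := by fun_prop
      exact this.continuousAt.tendsto.mono_left nhdsWithin_le_nhds
    refine le_of_tendsto_of_tendsto t1 t2 ?_
    have ev : ∀ᶠ y in nhds x, ∀ k ∈ S, 0 < w k y := by
      rw [Finset.eventually_all]
      intro k hk
      exact (hwc k).continuousAt.eventually (lt_mem_nhds (hS k hk))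
    filter_upwards [nhdsWithin_le_nhds ev, self_mem_nhdsWithin] with y hy hyP
    have hneg : ∀ k ∈ S, u k y ≤ 0 := fun k hk => by
      have := hwpos k y (hy k hk)
      linarith [hy k hk]
    refine (pw S y hyP hneg).trans ?_
    have h1 : ∑ k ∈ S, f k y ≤ 0 := Finset.sum_nonpos fun k _ => hf_nonpos k y hyP
    have h2 : ∑ j ∈ S, (∑ k ∈ Sᶜ, c k j y) * u j y ≤ 0 := by
      refine Finset.sum_nonpos fun j hj => ?_
      apply mul_nonpos_of_nonneg_of_nonpos _ (hneg j hj)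
      exact Finset.sum_nonneg fun k hk =>
        h_coop k j (fun h => (Finset.mem_compl.1 hk) (h ▸ hj)) y hyP
    linarith
  have core : ∀ (S : Finset (Fin n)) (x) (φ : (Fin d → ℝ) → ℝ), ContDiff ℝ 2 φ →
      (∀ k ∈ S, 0 < w k x) → IsLocalMax (fun y => φ y + ∑ k ∈ S, w k y) x →
      Lop X φ x ≤ K * ∑ j ∈ Sᶜ, w j x := by
    intro S x φ hφ hS hm
    have hsum : ContDiffAt ℝ 2 (fun y => ∑ k ∈ S, u k y) x :=
      ContDiffAt.sum fun k hk => hsm k x (hwpos k x (hS k hk)).1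
    have hm' : IsLocalMax (fun y => φ y + (-1) * ∑ k ∈ S, u k y) x := by
      have ev : ∀ᶠ y in nhds x, ∀ k ∈ S, 0 < w k y := by
        rw [Finset.eventually_all]
        intro k hk
        exact (hwc k).continuousAt.eventually (lt_mem_nhds (hS k hk))
      refine hm.congr ?_
      filter_upwards [ev] with y hy
      rw [neg_one_mul, ← Finset.sum_neg_distrib]
      congr 1
      exact Finset.sum_congr rfl fun k hk => (hwpos k y (hy k hk)).2
    have h1 := Lop_localMax (X := X) (hφ.contDiffAt.add (contDiffAt_const.mul hsum)) hm'
    rw [Lop_add hφ.contDiffAt (contDiffAt_const.mul hsum), Lop_smul,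
      Lop_sum S fun k hk => hsm k x (hwpos k x (hS k hk)).1] at h1
    linarith [lemA S x hS]
  -- the maximum of W
  have hWc : Continuous (fun x => ∑ k, w k x) := by fun_prop
  obtain ⟨x0, hx0⟩ : ∃ x0, ∀ x, ∑ k, w k x ≤ ∑ k, w k x0 := by
    obtain ⟨x0, _, hx0⟩ := (isCompact_Icc (a := (0 : Fin d → ℝ)) (b := 1)).exists_isMaxOn
      ⟨0, by simp⟩ hWc.continuousOn
    refine ⟨x0, fun x => ?_⟩
    have h1 := exists_shift x
    have h2 : ∑ k, w k x = ∑ k, w k (x + fun j => ((-⌊x j⌋ : ℤ) : ℝ)) :=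
      Finset.sum_congr rfl fun k _ => (hwper k x fun j => -⌊x j⌋).symm
    rw [h2]
    exact hx0 ⟨fun j => (h1 j).1, fun j => (h1 j).2.le⟩
  set m := ∑ k, w k x0 with hm
  have hWm : ∀ x, ∑ k, w k x = m := by
    have hv : Visc X 0 (fun x => m - ∑ k, w k x) := by
      intro x φ hφ hmin
      have := core (Finset.univ.filter fun k => 0 < w k x) x φ hφ (by simp) ?_
      · have h0 : ∑ j ∈ (Finset.univ.filter fun k => 0 < w k x)ᶜ, w j x = 0 := by
          refine Finset.sum_eq_zero fun j hj => ?_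
          simp at hj
          exact le_antisymm hj (hw0 j x)
        rw [h0] at this
        simpa using this
      · filter_upwards [hmin] with y hy
        have h1 : ∑ k ∈ Finset.univ.filter (fun k => 0 < w k x), w k y ≤ ∑ k, w k y :=
          Finset.sum_le_sum_of_subset_of_nonneg (Finset.filter_subset _ _) fun k _ _ => hw0 k y
        have h2 : ∑ k ∈ Finset.univ.filter (fun k => 0 < w k x), w k x = ∑ k, w k x := by
          refine Finset.sum_subset (Finset.filter_subset _ _) fun k _ hk => ?_
          simp at hk
          exact le_antisymm hk (hw0 k x)
        try dsimp only at hy ⊢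
        linarith
    intro x
    have := visc_smp (w := fun x => m - ∑ k, w k x) hX_cont le_rfl (continuous_const.sub hWc) (fun x => sub_nonneg.2 (hx0 x)) hv
      (z := x0) (sub_self _) x
    linarith
  have hm0 : 0 ≤ m := Finset.sum_nonneg fun k _ => hw0 k x0
  rcases hm0.lt_or_eq with hmpos | hmz
  · exfalso
    have hvi : ∀ i, Visc X K (w i) := by
      intro i x φ hφ hmin
      set S := Finset.univ.filter fun k => k ≠ i ∧ 0 < w k x with hS
      have hSe : ∀ k, k ∉ S → k ≠ i → w k x = 0 := by
        intro k hk hki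
        simp [hS] at hk
        exact le_antisymm (hk hki) (hw0 k x)
      have hiS : i ∉ S := by simp [hS]
      have := core S x φ hφ (by simp [hS]) ?_
      · have h0 : ∑ j ∈ Sᶜ, w j x = w i x := by
          refine Finset.sum_eq_single i (fun j hj hji => hSe j (by simpa using hj) hji) ?_
          intro h
          simp [hiS] at h
        rwa [h0] at this
      · filter_upwards [hmin] with y hy
        have h1 : ∀ z, w i z + ∑ k ∈ S, w k z = ∑ k ∈ insert i S, w k z := fun z =>
          (Finset.sum_insert (f := fun k => w k z) hiS).symm
        have h2 : ∑ k ∈ insert i S, w k y ≤ ∑ k, w k y :=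
          Finset.sum_le_sum_of_subset_of_nonneg (Finset.subset_univ _) fun k _ _ => hw0 k y
        have h3 : ∑ k ∈ insert i S, w k x = ∑ k, w k x := by
          refine Finset.sum_subset (Finset.subset_univ _) fun k _ hk => ?_
          simp only [Finset.mem_insert, not_or] at hk
          exact hSe k hk.2 hk.1
        have h4 := h1 y
        have h5 := h1 x
        rw [hWm] at h2 h3
        try dsimp only at hy ⊢
        linarith
    have hdich : ∀ i x y, w i x = 0 → w i y = 0 := fun i x y h =>
      visc_smp hX_cont hK0 (hwc i) (hw0 i) (hvi i) h y
    set β := Finset.univ.filter fun k => 0 < w k x0 with hβ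
    have hβpos : ∀ k ∈ β, ∀ x, 0 < w k x := by
      intro k hk x
      refine lt_of_le_of_ne (hw0 k x) fun h => ?_
      have := hdich k x x0 h.symm
      simp [hβ, this] at hk
    have hβz : ∀ k ∈ βᶜ, ∀ x, w k x = 0 := by
      intro k hk x
      simp [hβ] at hk
      exact hdich k x0 x (le_antisymm hk (hw0 k x0))
    have hβne : β.Nonempty := by
      rw [Finset.nonempty_iff_ne_empty]
      intro h
      have : m = 0 := by
        refine Finset.sum_eq_zero fun k _ => hβz k (by simp [h]) x0
      linarith
    have hLz : ∀ x, ∑ k ∈ β, Lop X (u k) x = 0 := by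
      intro x
      rw [← Lop_sum β fun k hk => hsm k x (hwpos k x (hβpos k hk x)).1]
      have : (fun y => ∑ k ∈ β, u k y) = fun _ => -m := by
        funext y
        rw [← hWm y, ← Finset.sum_add_sum_compl β, Finset.sum_eq_zero (s := βᶜ) fun k hk => hβz k hk y,
          add_zero, ← Finset.sum_neg_distrib]
        refine Finset.sum_congr rfl fun k hk => ?_
        linarith [(hwpos k y (hβpos k hk y)).2]
      rw [this, Lop_const]
    have hun : ∀ k ∈ β, ∀ x, u k x < 0 := fun k hk x => by
      have := (hwpos k x (hβpos k hk x)).2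
      linarith [hβpos k hk x]
    have key : ∀ x ∈ (⋃ k, P k)ᶜ,
        0 ≤ ∑ k ∈ β, f k x + ∑ j ∈ β, (∑ k ∈ βᶜ, c k j x) * u j x := by
      intro x hx
      have := pw β x hx fun k hk => (hun k hk x).le
      rw [hLz, Finset.sum_eq_zero (s := βᶜ) (f := fun j => w j x) fun k hk => hβz k hk x] at this
      simpa using this
    have kf : ∀ x ∈ (⋃ k, P k)ᶜ, ∑ k ∈ β, f k x ≤ 0 := fun x hx =>
      Finset.sum_nonpos fun k _ => hf_nonpos k x hx
    by_cases hα : (βᶜ).Nonempty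
    · obtain ⟨i, hi, j, hj, x, hx, hcx⟩ := h_coupled βᶜ β hα hβne disjoint_compl_left
        (by rw [Finset.union_comm, Finset.union_compl])
      have hcc : ∀ l ∈ β, ∀ k ∈ βᶜ, 0 ≤ c k l x := fun l hl k hk =>
        h_coop k l (fun h => (Finset.mem_compl.1 hk) (h ▸ hl)) x hx
      have h1 : ∑ j ∈ β, (∑ k ∈ βᶜ, c k j x) * u j x < 0 := by
        refine Finset.sum_neg' (fun l hl => ?_) ⟨j, hj, ?_⟩
        · exact mul_nonpos_of_nonneg_of_nonpos (Finset.sum_nonneg (hcc l hl)) (hun l hl x).le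
        · apply mul_neg_of_pos_of_neg _ (hun j hj x)
          exact Finset.sum_pos' (hcc j hj) ⟨i, hi, lt_of_le_of_ne (hcc j hj i hi) hcx.symm⟩
      linarith [key x hx, kf x hx]
    · rw [Finset.not_nonempty_iff_eq_empty] at hα
      have hall : ∀ k, k ∈ β := fun k => by
        by_contra h
        have : k ∈ βᶜ := by simpa using h
        simp [hα] at this
      rcases hcond with ⟨i₀, p₀, hp₀, hf₀⟩ | ⟨p, hp⟩
      · have h1 := key p₀ hp₀
        rw [hα] at h1
        simp only [Finset.sum_empty, zero_mul, Finset.sum_const_zero, add_zero] at h1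
        have h2 : ∑ k ∈ β, f k p₀ < 0 :=
          Finset.sum_neg' (fun k _ => hf_nonpos k p₀ hp₀) ⟨i₀, hall i₀, hf₀⟩
        linarith
      · obtain ⟨k, hk⟩ := Set.mem_iUnion.1 hp
        exact (hwpos k p (hβpos k (hall k) p)).1 hk
  · have hwz : ∀ i x, w i x = 0 := by
      intro i x
      have h1 := hWm x
      rw [← hmz] at h1
      exact (Finset.sum_eq_zero_iff_of_nonneg fun k _ => hw0 k x).1 h1 i (Finset.mem_univ i)
    have hu0 : ∀ i x, x ∉ P i → 0 ≤ u i x := by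
      intro i x hx
      have := hwu i x hx
      rw [hwz] at this
      linarith
    have hsup : ∀ i x, x ∉ P i → Lop X (u i) x ≤ C * u i x := by
      intro i x hx
      have := hnb x
      have t1 := (Lop_continuousAt hX_cont (hsm i x hx)).tendsto.mono_left
        (nhdsWithin_le_nhds (s := (⋃ k, P k)ᶜ))
      have t2 := ((hsm i x hx).continuousAt.tendsto.const_mul C).mono_left
        (nhdsWithin_le_nhds (s := (⋃ k, P k)ᶜ))
      refine le_of_tendsto_of_tendsto t1 t2 ?_
      filter_upwards [self_mem_nhdsWithin] with y hy
      have h1 := hPDE' i y hy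
      have h2 : -(C * u i y) ≤ ∑ j, c i j y * u j y := by
        rw [← Finset.add_sum_erase _ _ (Finset.mem_univ i)]
        have h3 : 0 ≤ ∑ j ∈ Finset.univ.erase i, c i j y * u j y :=
          Finset.sum_nonneg fun j hj => mul_nonneg
            (h_coop i j (Finset.ne_of_mem_erase hj).symm y hy) (hu0 j y (hnP hy j))
        have h4 := (abs_le.1 (hC i i y hy)).1
        nlinarith [hu0 i y (hnP hy i)]
      linarith [hf_nonpos i y hy]
    set z : Fin n → (Fin d → ℝ) → ℝ := fun j x => if x ∈ P j then 1 else min (u j x) 1 with hz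
    have hzP : ∀ j x, x ∈ P j → z j x = 1 := fun j x hx => by simp [hz, hx]
    have hzN : ∀ j x, x ∉ P j → z j x = min (u j x) 1 := fun j x hx => by simp [hz, hx]
    have hzc : ∀ j, Continuous (z j) := by
      intro j
      refine glue_cont (hcl j) (hu_smooth j).continuousOn (hu_inf j) (g := fun t => min t 1)
        (by fun_prop) (a := 1) (fun t ht => min_eq_right (by linarith)) (hzP j) (hzN j)
    have hz0 : ∀ j x, 0 ≤ z j x := by
      intro j x
      by_cases hx : x ∈ P j
      · rw [hzP j x hx]; norm_num
      · rw [hzN j x hx]; exact le_min (hu0 j x hx) (by norm_num)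
    have hz1 : ∀ j x, z j x ≤ 1 := by
      intro j x
      by_cases hx : x ∈ P j
      · rw [hzP j x hx]
      · rw [hzN j x hx]; exact min_le_right _ _
    have hzlt : ∀ j x, z j x < 1 → x ∉ P j ∧ z j x = u j x := by
      intro j x h
      by_cases hx : x ∈ P j
      · rw [hzP j x hx] at h; exact absurd h (lt_irrefl _)
      · refine ⟨hx, ?_⟩
        rw [hzN j x hx] at h ⊢
        rcases min_lt_iff.1 h with h | h
        · exact min_eq_left h.le
        · exact absurd h (lt_irrefl _)
    have hvz : ∀ i, Visc X C (z i) := by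
      intro i x φ hφ hmin
      rcases (hz1 i x).lt_or_eq with h | h
      · obtain ⟨hxP, hxe⟩ := hzlt i x h
        have hm' : IsLocalMax (fun y => φ y + (-1) * u i y) x := by
          filter_upwards [hmin, (hzc i).continuousAt.eventually (gt_mem_nhds h)] with y hy hy1
          have := (hzlt i y hy1).2
          try dsimp only at hy ⊢
          linarith
        have h1 := Lop_localMax (X := X) (hφ.contDiffAt.add (contDiffAt_const.mul (hsm i x hxP))) hm'
        rw [Lop_add hφ.contDiffAt (contDiffAt_const.mul (hsm i x hxP)), Lop_smul] at h1
        rw [hxe]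
        linarith [hsup i x hxP]
      · have hm' : IsLocalMax φ x := by
          filter_upwards [hmin] with y hy
          have := hz1 i y
          try dsimp only at hy
          linarith
        have h1 := Lop_localMax (X := X) hφ.contDiffAt hm'
        rw [h]
        linarith
    have hdich : ∀ i x y, z i x = 0 → z i y = 0 := fun i x y h =>
      visc_smp hX_cont hC0 (hzc i) (hz0 i) (hvz i) h y
    intro x hx i
    refine lt_of_le_of_ne (hu0 i x (hnP hx i)) fun hix => ?_
    have hzi : z i x = 0 := by
      rw [hzN i x (hnP hx i), ← hix]; norm_num
    set α := Finset.univ.filter fun k => z k x = 0 with hα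
    have hαz : ∀ k ∈ α, ∀ y, z k y = 0 := by
      intro k hk y
      simp [hα] at hk
      exact hdich k x y hk
    have hαu : ∀ k ∈ α, ∀ y, y ∉ P k ∧ u k y = 0 := by
      intro k hk y
      have h0 := hαz k hk y
      have h1 := hzlt k y (by rw [h0]; norm_num)
      exact ⟨h1.1, by rw [← h1.2, h0]⟩
    have hLα : ∀ k ∈ α, ∀ y, Lop X (u k) y = 0 := by
      intro k hk y
      have : u k = fun _ => 0 := funext fun y => (hαu k hk y).2
      rw [this, Lop_const]
    by_cases hβ : (αᶜ).Nonempty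
    · obtain ⟨k, hk, j, hj, y, hy, hcy⟩ := h_coupled α αᶜ ⟨i, by simp [hα, hzi]⟩ hβ
        disjoint_compl_right (by simp)
      have hjpos : 0 < u j y := by
        refine lt_of_le_of_ne (hu0 j y (hnP hy j)) fun h => ?_
        have : z j y = 0 := by rw [hzN j y (hnP hy j), ← h]; norm_num
        have := hdich j y x this
        simp [hα, this] at hj
      have hkj : k ≠ j := fun h => (Finset.mem_compl.1 hj) (h ▸ hk)
      have h1 := hPDE' k y hy
      rw [hLα k hk] at h1
      have h2 : 0 < ∑ l, c k l y * u l y := by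
        refine Finset.sum_pos' (fun l _ => ?_) ⟨j, Finset.mem_univ j, ?_⟩
        · by_cases hl : k = l
          · subst hl
            rw [(hαu k hk y).2, mul_zero]
          · exact mul_nonneg (h_coop k l hl y hy) (hu0 l y (hnP hy l))
        · exact mul_pos (lt_of_le_of_ne (h_coop k j hkj y hy) hcy.symm) hjpos
      linarith [hf_nonpos k y hy]
    · rw [Finset.not_nonempty_iff_eq_empty] at hβ
      have hall : ∀ k, k ∈ α := fun k => by
        by_contra h
        have : k ∈ αᶜ := by simpa using h
        simp [hβ] at this
      rcases hcond with ⟨i₀, p₀, hp₀, hf₀⟩ | ⟨p, hp⟩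
      · have h1 := hPDE' i₀ p₀ hp₀
        rw [hLα i₀ (hall i₀), Finset.sum_eq_zero fun j _ => by rw [(hαu j (hall j) p₀).2, mul_zero]] at h1
        linarith
      · obtain ⟨k, hk⟩ := Set.mem_iUnion.1 hp
        exact (hαu k (hall k) p).1 hk
end

section
/- In the periodic maximum-principle setting described below, assume that ∑_{i=1}^n u_i ≥ 0 on ℝ^d∖P. Then either u_i(x) > 0 for every x ∈ ℝ^d∖P and every 1 ≤ i ≤ n, or u_i ≡ 0 on ℝ^d for every 1 ≤ i ≤ n (the latter forcing P = ∅). -/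
open Filter Topology

noncomputable def mpL {d : ℕ} (X : (Fin d → ℝ) → (Fin d → ℝ)) (g : (Fin d → ℝ) → ℝ) (x : Fin d → ℝ) : ℝ :=
  (∑ k, fderiv ℝ (fun y => fderiv ℝ g y (Pi.single k 1)) x (Pi.single k 1)) +
      (∑ k, X x k * fderiv ℝ g x (Pi.single k 1))

def mpVisc {d : ℕ} (X : (Fin d → ℝ) → (Fin d → ℝ)) (v g : (Fin d → ℝ) → ℝ) : Prop :=
  ∀ x0 : Fin d → ℝ, ∀ φ : (Fin d → ℝ) → ℝ, ContDiff ℝ 2 φ → (∀ᶠ x in 𝓝 x0, φ x ≤ v x) →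
    φ x0 = v x0 → mpL X φ x0 ≤ g x0

lemma mp_fd_diff {d : ℕ} {g : (Fin d → ℝ) → ℝ} {x : Fin d → ℝ} (hg : ContDiffAt ℝ 2 g x) :
    DifferentiableAt ℝ (fderiv ℝ g) x :=
  (hg.fderiv_right (m := 1) (by norm_num)).differentiableAt (by norm_num)

lemma mp_ev_diff {d : ℕ} {g : (Fin d → ℝ) → ℝ} {x : Fin d → ℝ} (hg : ContDiffAt ℝ 2 g x) :
    ∀ᶠ y in 𝓝 x, DifferentiableAt ℝ g y := by
  filter_upwards [hg.eventually (by simp)] with y hy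
  exact hy.differentiableAt (by norm_num)

lemma mpL_congr {d : ℕ} (X : (Fin d → ℝ) → (Fin d → ℝ)) {g h : (Fin d → ℝ) → ℝ} {x : Fin d → ℝ}
    (e : g =ᶠ[𝓝 x] h) : mpL X g x = mpL X h x := by
  unfold mpL
  have e1 := e.fderiv (𝕜 := ℝ)
  congr 1
  · refine Finset.sum_congr rfl fun k _ => ?_
    have : (fun y => fderiv ℝ g y (Pi.single k 1)) =ᶠ[𝓝 x] (fun y => fderiv ℝ h y (Pi.single k 1)) := by
      filter_upwards [e1] with y hy
      rw [hy]
    rw [this.fderiv_eq]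
  · rw [e.fderiv_eq]

lemma mpL_add {d : ℕ} (X : (Fin d → ℝ) → (Fin d → ℝ)) {g h : (Fin d → ℝ) → ℝ} {x : Fin d → ℝ}
    (hg : ContDiffAt ℝ 2 g x) (hh : ContDiffAt ℝ 2 h x) :
    mpL X (fun y => g y + h y) x = mpL X g x + mpL X h x := by
  unfold mpL
  have e : ∀ᶠ y in 𝓝 x, fderiv ℝ (fun y => g y + h y) y = fderiv ℝ g y + fderiv ℝ h y := by
    filter_upwards [mp_ev_diff hg, mp_ev_diff hh] with y h1 h2
    exact fderiv_fun_add h1 h2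
  have e2 : ∀ k, fderiv ℝ (fun y => fderiv ℝ (fun y => g y + h y) y (Pi.single k 1)) x =
      fderiv ℝ (fun y => fderiv ℝ g y (Pi.single k 1)) x
        + fderiv ℝ (fun y => fderiv ℝ h y (Pi.single k 1)) x := by
    intro k
    have : (fun y => fderiv ℝ (fun y => g y + h y) y (Pi.single k 1)) =ᶠ[𝓝 x]
      (fun y => fderiv ℝ g y (Pi.single k 1) + fderiv ℝ h y (Pi.single k 1)) := by
      filter_upwards [e] with y hy
      rw [hy]; rfl
    rw [this.fderiv_eq]
    exact fderiv_fun_add ((mp_fd_diff hg).clm_apply (differentiableAt_const _))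
      ((mp_fd_diff hh).clm_apply (differentiableAt_const _))
  simp only [e2, e.self_of_nhds, add_apply, mul_add, Finset.sum_add_distrib]
  ring

lemma mpL_const {d : ℕ} (X : (Fin d → ℝ) → (Fin d → ℝ)) (C : ℝ) (x : Fin d → ℝ) :
    mpL X (fun _ => C) x = 0 := by
  simp [mpL]

lemma mpL_sum {d n : ℕ} (X : (Fin d → ℝ) → (Fin d → ℝ)) (C : ℝ) {u : Fin n → (Fin d → ℝ) → ℝ} {x : Fin d → ℝ}
    (B : Finset (Fin n)) (h : ∀ i ∈ B, ContDiffAt ℝ 2 (u i) x) :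
    ContDiffAt ℝ 2 (fun y => C + ∑ i ∈ B, u i y) x ∧
    mpL X (fun y => C + ∑ i ∈ B, u i y) x = ∑ i ∈ B, mpL X (u i) x := by
  induction B using Finset.induction_on with
  | empty => simp [mpL_const, contDiffAt_const]
  | insert a s ha ih =>
    obtain ⟨h1, h2⟩ := ih (fun i hi => h i (Finset.mem_insert_of_mem hi))
    have h3 := h a (Finset.mem_insert_self _ _)
    have e : (fun y => C + ∑ i ∈ insert a s, u i y) = fun y => u a y + (C + ∑ i ∈ s, u i y) := by
      funext y; rw [Finset.sum_insert ha]; ring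
    rw [e, mpL_add X h3 h1, Finset.sum_insert ha, h2]
    exact ⟨h3.add h1, rfl⟩

lemma mpL_cont {d : ℕ} {X : (Fin d → ℝ) → (Fin d → ℝ)} (hX : Continuous X)
    {g : (Fin d → ℝ) → ℝ} {x : Fin d → ℝ}
    (hg : ContDiffAt ℝ 2 g x) : ContinuousAt (mpL X g) x := by
  have h1 : ContDiffAt ℝ 1 (fderiv ℝ g) x := hg.fderiv_right (m := 1) (by norm_num)
  unfold mpL
  refine ContinuousAt.add ?_ ?_
  · refine tendsto_finsetSum _ fun k _ => ?_
    have h2 : ContDiffAt ℝ 1 (fun y => fderiv ℝ g y (Pi.single k 1)) x := h1.clm_apply contDiffAt_const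
    have h3 : ContDiffAt ℝ 0 (fderiv ℝ (fun y => fderiv ℝ g y (Pi.single k 1))) x :=
      h2.fderiv_right (m := 0) (by norm_num)
    exact (h3.clm_apply (contDiffAt_const (c := (Pi.single k 1 : Fin d → ℝ)))).continuousAt
  · refine tendsto_finsetSum _ fun k _ => ?_
    refine ContinuousAt.mul (f := fun y => X y k) ((continuous_apply k).comp hX).continuousAt ?_
    exact (h1.clm_apply (contDiffAt_const (c := (Pi.single k 1 : Fin d → ℝ)))).continuousAt

lemma mp_second {g : ℝ → ℝ} (hm : IsLocalMin g 0) (hc : ContinuousAt g 0) : 0 ≤ deriv (deriv g) 0 := by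
  by_contra! h
  have h1 := isLocalMax_of_deriv_deriv_neg h hm.deriv_eq_zero hc
  have h2 : g =ᶠ[𝓝 0] fun _ => g 0 := by
    filter_upwards [hm, h1] with y a b
    exact le_antisymm b a
  have h3 := h2.deriv.deriv_eq
  simp at h3
  linarith

lemma mpL_min {d : ℕ} (X : (Fin d → ℝ) → (Fin d → ℝ)) {g : (Fin d → ℝ) → ℝ} {x : Fin d → ℝ}
    (hg : ContDiffAt ℝ 2 g x) (hm : IsLocalMin g x) : 0 ≤ mpL X g x := by
  unfold mpL
  rw [hm.fderiv_eq_zero]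
  simp only [zero_apply, mul_zero, Finset.sum_const_zero, add_zero]
  refine Finset.sum_nonneg fun k _ => ?_
  set e : Fin d → ℝ := Pi.single k 1
  let l : ℝ → (Fin d → ℝ) := fun t => x + t • e
  have hl0 : l 0 = x := by simp [l]
  have hl : ∀ t, HasDerivAt l e t := by
    intro t
    have := ((hasDerivAt_id t).smul_const e).const_add x
    rw [one_smul] at this
    exact this
  have hlc : Tendsto l (𝓝 0) (𝓝 x) := by
    have := (hl 0).continuousAt.tendsto
    rwa [hl0] at this
  have h1 : deriv (g ∘ l) =ᶠ[𝓝 0] fun t => fderiv ℝ g (l t) e := by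
    filter_upwards [hlc.eventually (mp_ev_diff hg)] with t ht
    exact (ht.hasFDerivAt.comp_hasDerivAt t (hl t)).deriv
  have h2 : deriv (deriv (g ∘ l)) 0 = fderiv ℝ (fun y => fderiv ℝ g y e) x e := by
    rw [h1.deriv_eq]
    have hd : DifferentiableAt ℝ (fun y => fderiv ℝ g y e) (l 0) := by
      rw [hl0]; exact (mp_fd_diff hg).clm_apply (differentiableAt_const _)
    have := (hd.hasFDerivAt.comp_hasDerivAt 0 (hl 0)).deriv
    rw [hl0] at this
    exact this
  rw [← h2]
  apply mp_second
  · have : ∀ᶠ t in 𝓝 (0:ℝ), g x ≤ g (l t) := hlc.eventually hm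
    filter_upwards [this] with t ht
    simpa [hl0] using ht
  · apply ContinuousAt.comp
    · rw [hl0]; exact hg.continuousAt
    · exact (hl 0).continuousAt

lemma mpL_le {d : ℕ} (X : (Fin d → ℝ) → (Fin d → ℝ)) {φ ψ : (Fin d → ℝ) → ℝ} {x : Fin d → ℝ}
    (hφ : ContDiffAt ℝ 2 φ x) (hψ : ContDiffAt ℝ 2 ψ x) (hle : ∀ᶠ y in 𝓝 x, φ y ≤ ψ y)
    (heq : φ x = ψ x) : mpL X φ x ≤ mpL X ψ x := by
  have hg : ContDiffAt ℝ 2 (fun y => ψ y - φ y) x := hψ.sub hφ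
  have h1 : 0 ≤ mpL X (fun y => ψ y - φ y) x := by
    apply mpL_min X hg
    filter_upwards [hle] with y hy
    simp only [heq]; linarith
  have h2 := mpL_add X hg hφ
  simp only [sub_add_cancel] at h2
  linarith

lemma mpL_exp {d : ℕ} (X : (Fin d → ℝ) → (Fin d → ℝ)) (y x : Fin d → ℝ) (a ε C : ℝ) :
    mpL X (fun z => ε * Real.exp (-a * ∑ k, (z k - y k)^2) + C) x =
      ε * Real.exp (-a * ∑ k, (x k - y k)^2) *
        (4 * a^2 * ∑ k, (x k - y k)^2 - 2 * a * d - 2 * a * ∑ k, X x k * (x k - y k)) := by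
  have h1 : ∀ z : Fin d → ℝ, ∀ k, fderiv ℝ (fun z : Fin d → ℝ => ε * Real.exp (-a * ∑ k, (z k - y k)^2) + C) z (Pi.single k 1)
      = ε * Real.exp (-a * ∑ k, (z k - y k)^2) * (-2 * a * (z k - y k)) := by
    intro z k
    have hq : HasFDerivAt (fun z : Fin d → ℝ => ∑ k, (z k - y k)^2)
        (∑ k, (2 * (z k - y k)) • (ContinuousLinearMap.proj k : (Fin d → ℝ) →L[ℝ] ℝ)) z := by
      refine HasFDerivAt.fun_sum fun j _ => ?_
      have := (((ContinuousLinearMap.proj (R := ℝ) (φ := fun _ : Fin d => ℝ) j).hasFDerivAt (x := z)).sub_const (y j)).pow 2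
      simpa using this
    have := (((hq.const_mul (-a)).exp).const_mul ε).add_const C
    rw [this.fderiv]
    simp [Pi.single_apply]
    ring
  have h2 : ∀ k, fderiv ℝ (fun z => fderiv ℝ (fun z : Fin d → ℝ => ε * Real.exp (-a * ∑ k, (z k - y k)^2) + C) z (Pi.single k 1)) x (Pi.single k 1)
      = ε * Real.exp (-a * ∑ k, (x k - y k)^2) * (4 * a^2 * (x k - y k)^2 - 2 * a) := by
    intro k
    simp only [h1]
    have hE : DifferentiableAt ℝ (fun z : Fin d → ℝ => ε * Real.exp (-a * ∑ k, (z k - y k)^2) + C) x := by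
      fun_prop
    have hl : HasFDerivAt (fun z : Fin d → ℝ => -2 * a * (z k - y k))
       ((-2 * a) • (ContinuousLinearMap.proj k : (Fin d → ℝ) →L[ℝ] ℝ)) x := 
      (((ContinuousLinearMap.proj (R := ℝ) (φ := fun _ : Fin d => ℝ) k).hasFDerivAt (x := x)).sub_const (y k)).const_mul _
    have hh := (hE.hasFDerivAt.sub_const C).mul hl
    have : (fun z : Fin d → ℝ => ε * Real.exp (-a * ∑ k, (z k - y k)^2) * (-2 * a * (z k - y k))) =
      (fun z : Fin d → ℝ => ((ε * Real.exp (-a * ∑ k, (z k - y k)^2) + C) - C) * (-2 * a * (z k - y k))) := by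
      funext z; ring
    rw [this]
    erw [hh.fderiv]
    simp only [add_apply, smul_apply, h1, ContinuousLinearMap.proj_apply]
    simp
    ring
  unfold mpL
  simp only [h2]
  simp only [h1]
  generalize ε * Real.exp (-a * ∑ k, (x k - y k)^2) = E
  have e1 : ∑ k, X x k * (E * (-2 * a * (x k - y k))) = E * (-(2 * a * ∑ k, X x k * (x k - y k))) := by
    rw [Finset.mul_sum, ← Finset.sum_neg_distrib, Finset.mul_sum]
    exact Finset.sum_congr rfl fun k _ => by ring
  rw [e1, ← Finset.mul_sum, Finset.sum_sub_distrib, ← Finset.mul_sum]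
  simp only [Finset.sum_const, Finset.card_univ, Fintype.card_fin, nsmul_eq_mul]
  ring
open Filter Topology

lemma mp_smp {d : ℕ} {X : (Fin d → ℝ) → (Fin d → ℝ)} (hX : Continuous X)
    {v : (Fin d → ℝ) → ℝ} (hv : Continuous v) (hv0 : ∀ x, 0 ≤ v x) {M : ℝ} (hM : 0 ≤ M)
    (hvisc : mpVisc X v (fun x => M * v x)) {z : Fin d → ℝ} (hz : v z = 0) : ∀ x, v x = 0 := by
  by_contra! hcon
  obtain ⟨y, hy⟩ := hcon
  let e : (Fin d → ℝ) → (Fin d → ℝ) → ℝ := fun y x => ∑ k, (x k - y k)^2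
  have he : ∀ y, Continuous (e y) := fun y => by fun_prop
  have he0 : ∀ y x, 0 ≤ e y x := fun y x => Finset.sum_nonneg fun k _ => sq_nonneg _
  have hee : ∀ y x, e y x = 0 → x = y := by
    intro y x h
    have := (Finset.sum_eq_zero_iff_of_nonneg (fun k _ => sq_nonneg (x k - y k))).1 h
    funext k
    have := this k (Finset.mem_univ _)
    have := pow_eq_zero_iff (two_ne_zero) |>.1 this
    linarith
  -- nearest zero
  obtain ⟨x0, hx0, hmin⟩ : ∃ x0, v x0 = 0 ∧ ∀ x, v x = 0 → e y x0 ≤ e y x := by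
    have hK : IsCompact {x | v x = 0 ∧ e y x ≤ e y z} := by
      refine Metric.isCompact_of_isClosed_isBounded ?_ ?_
      · exact (isClosed_eq hv continuous_const).inter (isClosed_le (he y) continuous_const)
      · refine (Metric.isBounded_closedBall (x := y) (r := e y z + 1)).subset ?_
        rintro x ⟨-, hx⟩
        rw [Metric.mem_closedBall, dist_pi_le_iff (by linarith [he0 y z])]
        intro k
        have h1 : (x k - y k)^2 ≤ e y x :=
          Finset.single_le_sum (f := fun k => (x k - y k)^2) (fun k _ => sq_nonneg _) (Finset.mem_univ k)
        rw [Real.dist_eq]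
        have h2 := sq_abs (x k - y k)
        nlinarith [sq_nonneg (|x k - y k| - 1), abs_nonneg (x k - y k)]
    obtain ⟨x0, h0, hm⟩ := hK.exists_isMinOn ⟨z, hz, le_rfl⟩ (he y).continuousOn
    refine ⟨x0, h0.1, fun x hx => ?_⟩
    by_cases h : e y x ≤ e y z
    · exact hm ⟨hx, h⟩
    · exact h0.2.trans (le_of_not_ge h)
  have hR : 0 < e y x0 := by
    refine lt_of_le_of_ne (he0 _ _) fun h => ?_
    have := hee _ _ h.symm
    rw [this] at hx0
    exact hy hx0
  set y' : Fin d → ℝ := fun k => (x0 k + y k) / 2 with hy'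
  have hpar : ∀ x, e y x + e x0 x = 2 * e y' x + e y x0 / 2 := by
    intro x
    simp only [e, Finset.mul_sum, Finset.sum_div, ← Finset.sum_add_distrib]
    exact Finset.sum_congr rfl fun k _ => by simp only [hy']; ring
  set ρ : ℝ := e y x0 / 4 with hρ
  have hρ0 : 0 < ρ := by positivity
  have hx0' : e y' x0 = ρ := by
    have h1 := hpar x0
    have h2 : e x0 x0 = 0 := by simp [e]
    linarith
  have honly : ∀ x, e y' x ≤ ρ → v x = 0 → x = x0 := by
    intro x h1 h2
    have := hmin x h2
    have := hpar x
    exact hee _ _ (le_antisymm (by linarith) (he0 _ _))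
  -- small ball
  obtain ⟨r, hr, hball⟩ : ∃ r > 0, ∀ x ∈ Metric.closedBall x0 r, ρ / 2 ≤ e y' x := by
    have : ∀ᶠ x in 𝓝 x0, ρ / 2 < e y' x := 
      (he y').continuousAt.eventually (lt_mem_nhds (by rw [hx0']; linarith))
    obtain ⟨r, hr, h⟩ := Metric.nhds_basis_closedBall.eventually_iff.1 this
    exact ⟨r, hr, fun x hx => (h hx).le⟩
  have hNc : IsCompact (Metric.closedBall x0 r) := isCompact_closedBall _ _
  obtain ⟨C, hC⟩ : ∃ C, ∀ x ∈ Metric.closedBall x0 r, ‖∑ k, X x k * (x k - y' k)‖ ≤ C :=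
    hNc.exists_bound_of_continuousOn (Continuous.continuousOn (by fun_prop))
  have hC0 : 0 ≤ C := (norm_nonneg _).trans (hC x0 (Metric.mem_closedBall_self hr.le))
  set a : ℝ := max 1 ((d + C + M + 1) / (ρ / 2)) with ha
  have ha1 : 1 ≤ a := le_max_left _ _
  have ha2 : d + C + M + 1 ≤ a * (ρ / 2) := by
    rw [← div_le_iff₀ (by positivity)]; exact le_max_right _ _
  have hLpos : ∀ x ∈ Metric.closedBall x0 r,
      M < 4 * a^2 * e y' x - 2 * a * d - 2 * a * ∑ k, X x k * (x k - y' k) := by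
    intro x hx
    have h1 := hball x hx
    have h2 := (abs_le.1 (hC x hx)).2
    have h3 : d + C + M + 1 ≤ a * e y' x := ha2.trans (by gcongr)
    have hd0 : (0:ℝ) ≤ d := Nat.cast_nonneg d
    have h4 : 4 * a^2 * e y' x - 2 * a * d - 2 * a * ∑ k, X x k * (x k - y' k)
      = a * (4 * (a * e y' x) - 2 * d - 2 * ∑ k, X x k * (x k - y' k)) := by ring
    rw [h4]
    have h5 : M + 1 ≤ 4 * (a * e y' x) - 2 * d - 2 * ∑ k, X x k * (x k - y' k) := by linarith
    nlinarith
  obtain ⟨δ, hδ, hS⟩ : ∃ δ > 0, ∀ x ∈ Metric.sphere x0 r, e y' x ≤ ρ → δ ≤ v x := by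
    have hSc : IsCompact (Metric.sphere x0 r ∩ {x | e y' x ≤ ρ}) :=
      (isCompact_sphere x0 r).inter_right (isClosed_le (he y') continuous_const)
    rcases Set.eq_empty_or_nonempty (Metric.sphere x0 r ∩ {x | e y' x ≤ ρ}) with h | h
    · refine ⟨1, one_pos, fun x h1 h2 => ?_⟩
      have : x ∈ (∅ : Set (Fin d → ℝ)) := h ▸ ⟨h1, h2⟩
      exact this.elim
    · obtain ⟨x1, h1, h2⟩ := hSc.exists_isMinOn h hv.continuousOn
      refine ⟨v x1, lt_of_le_of_ne (hv0 _) fun h3 => ?_, fun x a b => h2 ⟨a, b⟩⟩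
      have := honly x1 h1.2 h3.symm
      have h4 := h1.1
      rw [this] at h4
      simp at h4
      linarith
  set ε := δ / 2 with hε
  have hε0 : 0 < ε := by positivity
  set h : (Fin d → ℝ) → ℝ := fun x => Real.exp (-a * e y' x) - Real.exp (-a * ρ) with hh
  have hhc : Continuous h := by
    have := he y'
    fun_prop
  obtain ⟨x1, hx1, hx1m⟩ := hNc.exists_isMinOn ⟨x0, Metric.mem_closedBall_self hr.le⟩
    (f := fun x => v x - ε * h x) (Continuous.continuousOn (by fun_prop))
  have hval : v x1 - ε * h x1 ≤ 0 := by
    have := hx1m (Metric.mem_closedBall_self hr.le)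
    simp only [Set.mem_setOf_eq, hx0, hh, hx0'] at this
    simpa [hh] using this
  have hin : x1 ∈ Metric.ball x0 r := by
    rcases lt_or_eq_of_le (Metric.mem_closedBall.1 hx1) with h1 | h1
    · exact h1
    · exfalso
      rcases le_or_gt (e y' x1) ρ with h2 | h2
      · have h3 := hS x1 h1 h2
        have h4 : h x1 ≤ 1 := by
          have : Real.exp (-a * e y' x1) ≤ 1 := Real.exp_le_one_iff.2 (by nlinarith [he0 y' x1])
          have := Real.exp_pos (-a * ρ)
          simp only [hh]; linarith
        nlinarith
      · have h4 : h x1 < 0 := by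
          have : Real.exp (-a * e y' x1) < Real.exp (-a * ρ) := Real.exp_lt_exp.2 (by nlinarith)
          simp only [hh]; linarith
        nlinarith [hv0 x1]
  set c := v x1 - ε * h x1 with hc
  have key := hvisc x1 (fun z => ε * Real.exp (-a * ∑ k, (z k - y' k)^2) + (c - ε * Real.exp (-a * ρ)))
    (by fun_prop) (by
      filter_upwards [Metric.isOpen_ball.mem_nhds hin] with x hx
      have h1 : c ≤ v x - ε * h x := hx1m (Metric.ball_subset_closedBall hx)
      simp only [hh, e] at h1
      linarith) (by
      simp only [hc, hh, e]; ring)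
  rw [mpL_exp] at key
  have h1 := hLpos x1 hx1
  have hE : 0 < ε * Real.exp (-a * ∑ k, (x1 k - y' k)^2) := by positivity
  have h2 := mul_lt_mul_of_pos_left h1 hE
  have h3 : v x1 ≤ ε * Real.exp (-a * ∑ k, (x1 k - y' k)^2) := by
    have h4 : v x1 ≤ ε * h x1 := by linarith
    have h5 : h x1 ≤ Real.exp (-a * ∑ k, (x1 k - y' k)^2) := by
      have := Real.exp_pos (-a * ρ)
      simp only [hh, e]; linarith
    exact h4.trans (by gcongr)
  have h6 := mul_le_mul_of_nonneg_left h3 hM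
  simp only [e] at h2
  linarith

lemma mp_min {d : ℕ} {v : (Fin d → ℝ) → ℝ} (hv : Continuous v)
    (hp : ∀ x (w : Fin d → ℤ), v (x + fun j => (w j : ℝ)) = v x) : ∃ z, ∀ x, v z ≤ v x := by
  obtain ⟨z, -, hz⟩ := (isCompact_Icc (a := (0 : Fin d → ℝ)) (b := 1)).exists_isMinOn
    ⟨0, by simp⟩ hv.continuousOn
  refine ⟨z, fun x => ?_⟩
  have h1 : v (fun j => Int.fract (x j)) = v x := by
    rw [← hp _ (fun j => ⌊x j⌋)]
    congr 1
    funext j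
    simp [Int.fract_add_floor]
  rw [← h1]
  apply hz
  constructor
  · intro j; exact Int.fract_nonneg _
  · intro j; exact (Int.fract_lt_one _).le

lemma mp_punct {d : ℕ} {P : Set (Fin d → ℝ)}
    (hPinv : ∀ x ∈ P, ∀ v : Fin d → ℤ, (x + fun j => (v j : ℝ)) ∈ P)
    (hPfin : (P ∩ {x | ∀ j, 0 ≤ x j ∧ x j < 1}).Finite) (x : Fin d → ℝ) :
    ∀ᶠ y in 𝓝[≠] x, y ∉ P := by
  have hfin : (P ∩ Metric.ball x 1).Finite := by
    have h2 := (Set.finite_Icc (fun j => ⌊x j - 1⌋) (fun j => ⌊x j + 1⌋)).image2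
      (fun (v : Fin d → ℤ) (p : Fin d → ℝ) => p + fun j => (v j : ℝ)) hPfin
    refine h2.subset ?_
    rintro p ⟨hp, hb⟩
    refine ⟨fun j => ⌊p j⌋, ⟨fun j => ?_, fun j => ?_⟩, fun j => Int.fract (p j), ⟨?_, fun j => ⟨Int.fract_nonneg _, Int.fract_lt_one _⟩⟩, ?_⟩
    · have := (dist_le_pi_dist p x j).trans_lt hb
      rw [Real.dist_eq, abs_lt] at this
      exact Int.floor_mono (by linarith)
    · have := (dist_le_pi_dist p x j).trans_lt hb
      rw [Real.dist_eq, abs_lt] at this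
      exact Int.floor_mono (by linarith)
    · have := hPinv p hp (fun j => -⌊p j⌋)
      convert this using 1
      funext j
      simp [Int.fract, sub_eq_add_neg]
    · funext j
      simp [Int.fract_add_floor]
  have h3 : ((P ∩ Metric.ball x 1) \ {x})ᶜ ∈ 𝓝 x :=
    (hfin.subset Set.diff_subset).isClosed.isOpen_compl.mem_nhds (by simp)
  rw [eventually_nhdsWithin_iff]
  filter_upwards [h3, Metric.ball_mem_nhds x one_pos] with y h4 h5 h6 h7
  exact h4 ⟨⟨h7, h5⟩, h6⟩
open Filter Topology

open Classical in
noncomputable def mpT {d : ℕ} (P : Set (Fin d → ℝ)) (u : (Fin d → ℝ) → ℝ) (b : ℝ) (x : Fin d → ℝ) : ℝ :=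
  if x ∈ P then b else min (u x) b

lemma mpT_le {d : ℕ} (P : Set (Fin d → ℝ)) (u : (Fin d → ℝ) → ℝ) (b : ℝ) (x : Fin d → ℝ) :
    mpT P u b x ≤ b := by
  unfold mpT; split_ifs
  · exact le_rfl
  · exact min_le_right _ _

lemma mpT_off {d : ℕ} {P : Set (Fin d → ℝ)} (u : (Fin d → ℝ) → ℝ) (b : ℝ) {x : Fin d → ℝ}
    (h : x ∉ P) : mpT P u b x = min (u x) b := by
  simp [mpT, h]

lemma mpT_on {d : ℕ} {P : Set (Fin d → ℝ)} (u : (Fin d → ℝ) → ℝ) (b : ℝ) {x : Fin d → ℝ}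
    (h : x ∈ P) : mpT P u b x = b := by
  simp [mpT, h]

lemma mpT_lt {d : ℕ} {P : Set (Fin d → ℝ)} {u : (Fin d → ℝ) → ℝ} {b : ℝ} {x : Fin d → ℝ}
    (h : mpT P u b x < b) : x ∉ P ∧ mpT P u b x = u x ∧ u x < b := by
  by_cases hx : x ∈ P
  · rw [mpT_on u b hx] at h; exact absurd h (lt_irrefl _)
  · rw [mpT_off u b hx] at h ⊢
    rcases le_total (u x) b with h1 | h1
    · rw [min_eq_left h1] at h ⊢; exact ⟨hx, rfl, h⟩
    · rw [min_eq_right h1] at h; exact absurd h (lt_irrefl _)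

lemma mpT_per {d : ℕ} {P : Set (Fin d → ℝ)} {u : (Fin d → ℝ) → ℝ} (b : ℝ)
    (hPinv : ∀ x ∈ P, ∀ v : Fin d → ℤ, (x + fun j => (v j : ℝ)) ∈ P)
    (hu : ∀ x (v : Fin d → ℤ), u (x + fun j => (v j : ℝ)) = u x) (x : Fin d → ℝ) (v : Fin d → ℤ) :
    mpT P u b (x + fun j => (v j : ℝ)) = mpT P u b x := by
  have : (x + fun j => (v j : ℝ)) ∈ P ↔ x ∈ P := by
    refine ⟨fun h => ?_, fun h => hPinv x h v⟩
    have := hPinv _ h (fun j => - v j)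
    convert this using 1
    funext j; simp
  by_cases h : x ∈ P
  · rw [mpT_on u b h, mpT_on u b (this.2 h)]
  · rw [mpT_off u b h, mpT_off u b (fun h' => h (this.1 h')), hu]

lemma mpT_cont {d : ℕ} {P : Set (Fin d → ℝ)} {u : (Fin d → ℝ) → ℝ} (b : ℝ)
    (hPc : IsClosed P) (hu : ContinuousOn u Pᶜ)
    (hinf : ∀ p ∈ P, Tendsto u (𝓝[Pᶜ] p) atTop) : Continuous (mpT P u b) := by
  rw [continuous_iff_continuousAt]
  intro x
  by_cases hx : x ∈ P
  · have h1 := (hinf x hx).eventually (eventually_ge_atTop b)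
    rw [eventually_nhdsWithin_iff] at h1
    have h2 : mpT P u b =ᶠ[𝓝 x] fun _ => b := by
      filter_upwards [h1] with y hy
      by_cases h : y ∈ P
      · exact mpT_on u b h
      · rw [mpT_off u b h]; exact min_eq_right (hy h)
    exact continuousAt_const.congr h2.symm
  · have h2 : mpT P u b =ᶠ[𝓝 x] fun y => min (u y) b := by
      filter_upwards [hPc.isOpen_compl.mem_nhds hx] with y hy
      exact mpT_off u b hy
    have h3 : ContinuousAt u x := hu.continuousAt (hPc.isOpen_compl.mem_nhds hx)
    have h4 : ContinuousAt (fun y => min (u y) b) x := h3.min continuousAt_const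
    exact h4.congr h2.symm

/-- the algebraic inequality -/
lemma mp_alg {n : ℕ} (c : Fin n → Fin n → ℝ) (u : Fin n → ℝ) (K : ℝ)
    (hK : ∀ i j, c i j ≤ K) (hK0 : 0 ≤ K)
    (hco : ∀ i j, i ≠ j → 0 ≤ c i j) (hcd : ∀ j, ∑ i, c i j ≤ 0)
    (B : Finset (Fin n)) (hB : ∀ i ∈ B, u i ≤ 0) :
    -(∑ i ∈ B, ∑ j, c i j * u j) ≤ (n * K) * ∑ j ∈ Bᶜ, (-(min (u j) 0)) := by
  rw [Finset.sum_comm, ← Finset.sum_add_sum_compl B]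
  have h1 : 0 ≤ ∑ j ∈ B, ∑ i ∈ B, c i j * u j := by
    refine Finset.sum_nonneg fun j hj => ?_
    rw [← Finset.sum_mul]
    refine mul_nonneg_of_nonpos_of_nonpos ?_ (hB j hj)
    have := hcd j
    rw [← Finset.sum_add_sum_compl B] at this
    have h2 : 0 ≤ ∑ i ∈ Bᶜ, c i j := Finset.sum_nonneg fun i hi => hco i j (by
      rintro rfl; exact (Finset.mem_compl.1 hi) hj)
    linarith
  have h2 : -(∑ j ∈ Bᶜ, ∑ i ∈ B, c i j * u j) ≤ (n * K) * ∑ j ∈ Bᶜ, (-(min (u j) 0)) := by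
    rw [Finset.mul_sum, ← Finset.sum_neg_distrib]
    refine Finset.sum_le_sum fun j hj => ?_
    rw [← Finset.sum_mul]
    have h3 : 0 ≤ ∑ i ∈ B, c i j := Finset.sum_nonneg fun i hi => hco i j (by
      rintro rfl; exact (Finset.mem_compl.1 hj) hi)
    have h4 : ∑ i ∈ B, c i j ≤ n * K := by
      calc ∑ i ∈ B, c i j ≤ ∑ i ∈ B, K := Finset.sum_le_sum fun i _ => hK i j
        _ = B.card * K := by simp
        _ ≤ n * K := by
          have : (B.card : ℝ) ≤ n := by exact_mod_cast (card_finset_fin_le B)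
          gcongr
    have h5 : min (u j) 0 ≤ u j := min_le_left _ _
    have h6 : min (u j) 0 ≤ 0 := min_le_right _ _
    nlinarith
  linarith

open Filter

/-- periodic maximum principle, condition (3): if `∑ u_i ≥ 0` on `ℝ^d∖P`,
then either all `u_i > 0` on `ℝ^d∖P`, or all `u_i ≡ 0` on `ℝ^d` (forcing `P = ∅`). -/
theorem stmt5 (d n : ℕ) (hd : 1 ≤ d) (hn : 1 ≤ n)
    (P : Fin n → Set (Fin d → ℝ))
    (hPinv : ∀ i, ∀ x ∈ P i, ∀ v : Fin d → ℤ, (x + fun j => (v j : ℝ)) ∈ P i)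
    (hPfin : ∀ i, ((P i) ∩ {x | ∀ j, 0 ≤ x j ∧ x j < 1}).Finite)
    (u : Fin n → (Fin d → ℝ) → ℝ)
    (hu_smooth : ∀ i, ContDiffOn ℝ 2 (u i) (P i)ᶜ)
    (hu_per : ∀ i x (v : Fin d → ℤ), u i (x + fun j => (v j : ℝ)) = u i x)
    (hu_inf : ∀ i, ∀ p ∈ P i, Tendsto (u i) (nhdsWithin p (P i)ᶜ) atTop)
    (c : Fin n → Fin n → (Fin d → ℝ) → ℝ)
    (hc_cont : ∀ i j, ContinuousOn (c i j) (⋃ k, P k)ᶜ)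
    (hc_bdd : ∀ i j, ∃ M : ℝ, ∀ x ∈ (⋃ k, P k)ᶜ, |c i j x| ≤ M)
    (hc_per : ∀ i j x (v : Fin d → ℤ), c i j (x + fun k => (v k : ℝ)) = c i j x)
    (h_coop : ∀ i j, i ≠ j → ∀ x ∈ (⋃ k, P k)ᶜ, 0 ≤ c i j x)
    (h_cdd : ∀ j, ∀ x ∈ (⋃ k, P k)ᶜ, ∑ i, c i j x ≤ 0)
    (h_coupled : ∀ α β : Finset (Fin n), α.Nonempty → β.Nonempty → Disjoint α β →
      α ∪ β = Finset.univ →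
      ∃ i ∈ α, ∃ j ∈ β, ∃ x ∈ (⋃ k, P k)ᶜ, c i j x ≠ 0)
    (X : (Fin d → ℝ) → (Fin d → ℝ))
    (hX_cont : Continuous X)
    (hX_per : ∀ x (v : Fin d → ℤ), X (x + fun k => (v k : ℝ)) = X x)
    (f : Fin n → (Fin d → ℝ) → ℝ)
    (hf_cont : ∀ i, ContinuousOn (f i) (⋃ k, P k)ᶜ)
    (hf_nonpos : ∀ i, ∀ x ∈ (⋃ k, P k)ᶜ, f i x ≤ 0)
    (hf_per : ∀ i x (v : Fin d → ℤ), f i (x + fun k => (v k : ℝ)) = f i x)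
    (hPDE : ∀ i, ∀ x ∈ (⋃ k, P k)ᶜ,
      (∑ k, fderiv ℝ (fun y => fderiv ℝ (u i) y (Pi.single k 1)) x (Pi.single k 1)) +
      (∑ k, X x k * fderiv ℝ (u i) x (Pi.single k 1)) +
      (∑ j, c i j x * u j x) = f i x)
    (hsum : ∀ x ∈ (⋃ k, P k)ᶜ, 0 ≤ ∑ i, u i x) :
    (∀ x ∈ (⋃ k, P k)ᶜ, ∀ i, 0 < u i x) ∨
      ((∀ i, ∀ x, u i x = 0) ∧ (⋃ k, P k) = ∅) := by
  classical
  have : NeZero d := ⟨by omega⟩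
  have : Nonempty (Fin d) := ⟨0⟩
  have : Nonempty (Fin n) := ⟨⟨0, by omega⟩⟩
  set Q : Set (Fin d → ℝ) := (⋃ k, P k)ᶜ with hQ
  have hQi : ∀ x ∈ Q, ∀ i, x ∉ P i := fun x hx i h => hx (Set.mem_iUnion_of_mem i h)
  have hev : ∀ x : Fin d → ℝ, ∀ᶠ y in 𝓝[≠] x, y ∈ Q := by
    intro x
    have : ∀ᶠ y in 𝓝[≠] x, ∀ i, y ∉ P i := eventually_all.2 fun i => mp_punct (hPinv i) (hPfin i) x
    filter_upwards [this] with y hy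
    simp only [hQ, Set.mem_compl_iff, Set.mem_iUnion, not_exists]
    exact hy
  have hne : ∀ x : Fin d → ℝ, NeBot (𝓝[≠] x) := fun x => inferInstance
  have hPc : ∀ i, IsClosed (P i) := by
    intro i
    rw [← isOpen_compl_iff, isOpen_iff_mem_nhds]
    intro x hx
    have := mp_punct (hPinv i) (hPfin i) x
    rw [eventually_nhdsWithin_iff] at this
    filter_upwards [this] with y hy
    by_cases h : y = x
    · rw [h]; exact hx
    · exact hy h
  have hCD : ∀ i x, x ∉ P i → ContDiffAt ℝ 2 (u i) x := fun i x hx =>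
    (hu_smooth i).contDiffAt ((hPc i).isOpen_compl.mem_nhds hx)
  have hL : ∀ i, ∀ x ∈ Q, mpL X (u i) x = f i x - ∑ j, c i j x * u j x := by
    intro i x hx
    have := hPDE i x hx
    unfold mpL
    linarith
  obtain ⟨K, hK0, hK⟩ : ∃ K : ℝ, 0 ≤ K ∧ ∀ i j, ∀ x ∈ Q, |c i j x| ≤ K := by
    choose M hM using hc_bdd
    refine ⟨∑ i, ∑ j, |M i j|, by positivity, fun i j x hx => ?_⟩
    calc |c i j x| ≤ |M i j| := (hM i j x hx).trans (le_abs_self _)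
      _ ≤ ∑ j, |M i j| := Finset.single_le_sum (f := fun j => |M i j|) (fun _ _ => abs_nonneg _) (Finset.mem_univ j)
      _ ≤ _ := Finset.single_le_sum (f := fun i => ∑ j, |M i j|) (fun _ _ => by positivity) (Finset.mem_univ i)
  have hTc : ∀ b i, Continuous (mpT (P i) (u i) b) := fun b i =>
    mpT_cont b (hPc i) (hu_smooth i).continuousOn (hu_inf i)
  set w : Fin n → (Fin d → ℝ) → ℝ := fun i => mpT (P i) (u i) 0 with hw
  have hwc : ∀ i, Continuous (w i) := hTc 0
  have hw0 : ∀ i x, w i x ≤ 0 := fun i x => mpT_le _ _ _ _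
  have hwQ : ∀ i, ∀ x ∈ Q, w i x = min (u i x) 0 := fun i x hx => mpT_off _ _ (hQi x hx i)
  -- viscosity inequality for partial sums
  have hV : ∀ (A : Finset (Fin n)) (C : ℝ),
      mpVisc X (fun x => C + ∑ i ∈ A, w i x) (fun x => (n * K) * ∑ j ∈ Aᶜ, (-(w j x))) := by
    intro A C x0 φ hφ hle heq
    set B := A.filter (fun i => w i x0 < 0) with hB
    have hB1 : ∀ i ∈ B, w i x0 < 0 := fun i hi => (Finset.mem_filter.1 hi).2
    have hBA : B ⊆ A := Finset.filter_subset _ _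
    have hz : ∀ i ∈ A, i ∉ B → w i x0 = 0 := by
      intro i hi hiB
      by_contra h
      exact hiB (Finset.mem_filter.2 ⟨hi, lt_of_le_of_ne (hw0 i x0) h⟩)
    have hcd : ∀ i ∈ B, ContDiffAt ℝ 2 (u i) x0 := fun i hi => hCD i x0 (mpT_lt (hB1 i hi)).1
    obtain ⟨hs1, hs2⟩ := mpL_sum X C B hcd
    have hneg : ∀ᶠ x in 𝓝 x0, ∀ i ∈ B, w i x < 0 := by
      rw [Filter.eventually_all_finset]
      intro i hi
      exact (hwc i).continuousAt.eventually (gt_mem_nhds (hB1 i hi))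
    have step1 : mpL X φ x0 ≤ ∑ i ∈ B, mpL X (u i) x0 := by
      rw [← hs2]
      apply mpL_le X hφ.contDiffAt hs1
      · filter_upwards [hle, hneg] with x h1 h2
        refine h1.trans ?_
        have h3 : ∑ i ∈ A, w i x ≤ ∑ i ∈ B, w i x := by
          rw [← Finset.sum_sdiff hBA]
          have : ∑ i ∈ A \ B, w i x ≤ 0 := Finset.sum_nonpos fun i _ => hw0 i x
          linarith
        have h4 : ∑ i ∈ B, w i x = ∑ i ∈ B, u i x :=
          Finset.sum_congr rfl fun i hi => (mpT_lt (h2 i hi)).2.1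
        linarith
      · rw [heq]
        have h3 : ∑ i ∈ B, w i x0 = ∑ i ∈ A, w i x0 := Finset.sum_subset hBA hz
        have h4 : ∑ i ∈ B, w i x0 = ∑ i ∈ B, u i x0 :=
          Finset.sum_congr rfl fun i hi => (mpT_lt (hB1 i hi)).2.1
        linarith
    have step2 : ∑ i ∈ B, mpL X (u i) x0 ≤ (n * K) * ∑ j ∈ Bᶜ, (-(w j x0)) := by
      have t1 : Tendsto (fun x => ∑ i ∈ B, mpL X (u i) x) (𝓝[≠] x0) (𝓝 (∑ i ∈ B, mpL X (u i) x0)) :=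
        (tendsto_finsetSum _ fun i hi => (mpL_cont hX_cont (hcd i hi)).tendsto).mono_left nhdsWithin_le_nhds
      have t2 : Tendsto (fun x => (n * K) * ∑ j ∈ Bᶜ, (-(w j x))) (𝓝[≠] x0)
          (𝓝 ((n * K) * ∑ j ∈ Bᶜ, (-(w j x0)))) := by
        have : Continuous (fun x => (n * K) * ∑ j ∈ Bᶜ, (-(w j x))) := by fun_prop
        exact this.continuousAt.tendsto.mono_left nhdsWithin_le_nhds
      refine le_of_tendsto_of_tendsto t1 t2 ?_
      filter_upwards [hev x0, hneg.filter_mono nhdsWithin_le_nhds] with x hx h2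
      have h3 := mp_alg (fun i j => c i j x) (fun i => u i x) K
        (fun i j => (le_abs_self _).trans (hK i j x hx)) hK0 (fun i j hij => h_coop i j hij x hx)
        (fun j => h_cdd j x hx) B (fun i hi => (mpT_lt (h2 i hi)).2.2.le)
      have h4 : ∑ j ∈ Bᶜ, (-(w j x)) = ∑ j ∈ Bᶜ, (-(min (u j x) 0)) :=
        Finset.sum_congr rfl fun j _ => by rw [hwQ j x hx]
      rw [h4]
      refine le_trans ?_ h3
      rw [← Finset.sum_neg_distrib]
      refine Finset.sum_le_sum fun i _ => ?_
      rw [hL i x hx]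
      linarith [hf_nonpos i x hx]
    have step3 : ∑ j ∈ Bᶜ, (-(w j x0)) = ∑ j ∈ Aᶜ, (-(w j x0)) := by
      symm
      apply Finset.sum_subset (Finset.compl_subset_compl.2 hBA)
      intro j hj hjA
      rw [hz j (by simpa using hjA) (by simpa using hj), neg_zero]
    simp only
    rw [← step3]
    exact step1.trans step2
  have hnK : 0 ≤ (n * K : ℝ) := by positivity
  -- the sum of negative parts is constant
  obtain ⟨z, hzmin⟩ := mp_min (v := fun x => ∑ i, w i x) (by fun_prop) (by
    intro x v
    exact Finset.sum_congr rfl fun i _ => mpT_per 0 (hPinv i) (hu_per i) x v)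
  set m : ℝ := -∑ i, w i z with hm
  have hW : ∀ x, m + ∑ i, w i x = 0 := by
    refine mp_smp hX_cont (v := fun x => m + ∑ i, w i x) (by fun_prop) (fun x => ?_) le_rfl ?_ (z := z) ?_
    · have := hzmin x
      linarith
    · have := hV Finset.univ m
      simpa using this
    · simp [hm]
  -- each w k is identically zero or everywhere negative
  have hdich : ∀ k, ∀ z, w k z = 0 → ∀ x, w k x = 0 := by
    intro k z hz x
    have e : ∀ x, m + ∑ i ∈ ({k} : Finset (Fin n))ᶜ, w i x = - w k x := by
      intro x
      have := hW x
      rw [← Finset.sum_add_sum_compl {k}, Finset.sum_singleton] at this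
      linarith
    have h1 := hV ({k} : Finset (Fin n))ᶜ m
    simp only [e, compl_compl, Finset.sum_singleton] at h1
    have h2 := mp_smp hX_cont (v := fun x => - w k x) (by fun_prop)
      (fun x => by linarith [hw0 k x]) hnK h1 (z := z) (by simp [hz]) x
    simpa using h2
  have hwz : ∀ i x, w i x = 0 := by
    by_contra! hcon
    obtain ⟨i0, x0, hi0⟩ := hcon
    set α := Finset.univ.filter (fun i => w i x0 = 0) with hα
    set β := Finset.univ.filter (fun i => w i x0 < 0) with hβ
    have hαw : ∀ i ∈ α, ∀ x, w i x = 0 := fun i hi => hdich i x0 (Finset.mem_filter.1 hi).2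
    have hβw : ∀ i ∈ β, ∀ x, w i x < 0 := by
      intro i hi x
      refine lt_of_le_of_ne (hw0 i x) fun h => ?_
      have := hdich i x h x0
      have := (Finset.mem_filter.1 hi).2
      linarith
    have hβne : β.Nonempty := ⟨i0, Finset.mem_filter.2 ⟨Finset.mem_univ _, lt_of_le_of_ne (hw0 _ _) hi0⟩⟩
    have hdis : Disjoint α β := by
      rw [Finset.disjoint_left]
      intro i h1 h2
      have := (Finset.mem_filter.1 h1).2
      have := (Finset.mem_filter.1 h2).2
      linarith
    have hun : α ∪ β = Finset.univ := by
      ext i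
      simp only [hα, hβ, Finset.mem_union, Finset.mem_filter, Finset.mem_univ, true_and, iff_true]
      exact (lt_or_eq_of_le (hw0 i x0)).symm
    have hcompl : βᶜ = α := by
      rw [Finset.compl_eq_univ_sdiff, ← hun]
      rw [Finset.union_sdiff_right, Finset.sdiff_eq_self_of_disjoint hdis]
    rcases α.eq_empty_or_nonempty with hαe | hαne
    · have hall : ∀ i, i ∈ β := by
        intro i
        rw [hαe, Finset.empty_union] at hun
        rw [hun]; exact Finset.mem_univ i
      obtain ⟨x, hx⟩ := (hev x0).exists
      have h1 := hsum x hx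
      have h2 : ∑ i, u i x < 0 := 
        Finset.sum_neg (fun i _ => (mpT_lt (hβw i (hall i) x)).2.2) Finset.univ_nonempty
      linarith
    · obtain ⟨i, hi, j, hj, x, hx, hne0⟩ := h_coupled α β hαne hβne hdis hun
      have hij : i ≠ j := fun h => (Finset.disjoint_left.1 hdis hi) (h ▸ hj)
      have hpos : 0 < c i j x := lt_of_le_of_ne (h_coop i j hij x hx) (Ne.symm hne0)
      have h0 : ∑ k ∈ β, mpL X (u k) x = 0 := by
        rw [← (mpL_sum X m β (fun k hk => hCD k x (mpT_lt (hβw k hk x)).1)).2]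
        have : (fun y => m + ∑ k ∈ β, u k y) = fun _ => 0 := by
          funext y
          have h1 := hW y
          rw [← Finset.sum_add_sum_compl β, hcompl, Finset.sum_eq_zero (s := α) (fun k hk => hαw k hk y)] at h1
          rw [← Finset.sum_congr rfl (fun k hk => (mpT_lt (hβw k hk y)).2.1)]
          linarith
        rw [this, mpL_const]
      have h1 : ∑ k ∈ β, mpL X (u k) x ≤ - ∑ k ∈ β, ∑ l, c k l x * u l x := by
        rw [← Finset.sum_neg_distrib]
        refine Finset.sum_le_sum fun k _ => ?_
        rw [hL k x hx]
        linarith [hf_nonpos k x hx]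
      have h2 : 0 < ∑ k ∈ β, ∑ l, c k l x * u l x := by
        rw [Finset.sum_comm]
        have hcolβ : ∀ l ∈ β, ∑ k ∈ β, c k l x ≤ - ∑ k ∈ α, c k l x := by
          intro l hl
          have := h_cdd l x hx
          rw [← Finset.sum_add_sum_compl β, hcompl] at this
          linarith
        have hαnn : ∀ l ∈ β, ∀ k ∈ α, 0 ≤ c k l x := fun l hl k hk =>
          h_coop k l (fun h => (Finset.disjoint_left.1 hdis hk) (h ▸ hl)) x hx
        have hun' : ∀ l ∈ β, u l x < 0 := fun l hl => (mpT_lt (hβw l hl x)).2.2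
        refine Finset.sum_pos' (fun l _ => ?_) ⟨j, Finset.mem_univ _, ?_⟩
        · rw [← Finset.sum_mul]
          by_cases hl : l ∈ β
          · refine mul_nonneg_of_nonpos_of_nonpos ?_ (hun' l hl).le
            have := Finset.sum_nonneg (hαnn l hl)
            linarith [hcolβ l hl]
          · have hlα : l ∈ α := by rw [← hcompl]; simpa using hl
            have h3 := hαw l hlα x
            rw [hwQ l x hx] at h3
            refine mul_nonneg (Finset.sum_nonneg fun k hk => h_coop k l (fun h => hl (h ▸ hk)) x hx) ?_
            exact min_eq_right_iff.1 h3
        · rw [← Finset.sum_mul]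
          refine mul_pos_of_neg_of_neg ?_ (hun' j hj)
          have := Finset.single_le_sum (f := fun k => c k j x) (hαnn j hj) hi
          linarith [hcolβ j hj]
      linarith
  have hnn : ∀ i x, x ∉ P i → 0 ≤ u i x := by
    intro i x hx
    have h := hwz i x
    simp only [hw] at h
    rw [mpT_off _ _ hx] at h
    exact min_eq_right_iff.1 h
  have hT0 : ∀ i x, 0 ≤ mpT (P i) (u i) 1 x := by
    intro i x
    by_cases hx : x ∈ P i
    · rw [mpT_on _ _ hx]; exact zero_le_one
    · rw [mpT_off _ _ hx]; exact le_min (hnn i x hx) zero_le_one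
  have hTvisc : ∀ i, mpVisc X (mpT (P i) (u i) 1) (fun x => K * mpT (P i) (u i) 1 x) := by
    intro i x0 φ hφ hle heq
    rcases lt_or_eq_of_le (mpT_le (P i) (u i) 1 x0) with h | h
    · obtain ⟨h1, h2, h3⟩ := mpT_lt h
      have step1 : mpL X φ x0 ≤ mpL X (u i) x0 := by
        apply mpL_le X hφ.contDiffAt (hCD i x0 h1)
        · filter_upwards [hle, (hPc i).isOpen_compl.mem_nhds h1] with x a b
          rw [mpT_off _ _ b] at a
          exact a.trans (min_le_left _ _)
        · rw [heq, h2]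
      have step2 : mpL X (u i) x0 ≤ K * u i x0 := by
        refine le_of_tendsto_of_tendsto
          ((mpL_cont hX_cont (hCD i x0 h1)).tendsto.mono_left (nhdsWithin_le_nhds (s := {x0}ᶜ)))
          ((((hCD i x0 h1).continuousAt.tendsto.const_mul K)).mono_left nhdsWithin_le_nhds) ?_
        filter_upwards [hev x0] with x hx
        rw [hL i x hx]
        have h6 : c i i x * u i x ≤ ∑ j, c i j x * u j x := by
          rw [← Finset.sum_add_sum_compl {i}, Finset.sum_singleton]
          have : 0 ≤ ∑ j ∈ ({i} : Finset (Fin n))ᶜ, c i j x * u j x :=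
            Finset.sum_nonneg fun j hj => mul_nonneg
              (h_coop i j (fun h => by simp [h] at hj) x hx) (hnn j x (hQi x hx j))
          linarith
        have h7 := (abs_le.1 (hK i i x hx)).1
        have h8 := hnn i x (hQi x hx i)
        have h9 := hf_nonpos i x hx
        nlinarith
      simp only [h2]
      exact step1.trans step2
    · have : mpL X φ x0 ≤ mpL X (fun _ => 1) x0 := by
        apply mpL_le X hφ.contDiffAt contDiffAt_const
        · filter_upwards [hle] with x a
          exact a.trans (mpT_le _ _ _ _)
        · rw [heq, h]
      rw [mpL_const] at this
      simp only [h]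
      linarith
  have hTd : ∀ i, ∀ z, mpT (P i) (u i) 1 z = 0 → ∀ x, x ∉ P i ∧ u i x = 0 := by
    intro i z hz x
    have h1 := mp_smp hX_cont (hTc 1 i) (hT0 i) hK0 (hTvisc i) hz x
    obtain ⟨a, b, -⟩ := mpT_lt (by rw [h1]; exact one_pos : mpT (P i) (u i) 1 x < 1)
    exact ⟨a, by rw [← b, h1]⟩
  set α := Finset.univ.filter (fun i => ∀ x, x ∉ P i ∧ u i x = 0) with hα
  set β := Finset.univ.filter (fun i => ¬ ∀ x, x ∉ P i ∧ u i x = 0) with hβ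
  have hpos : ∀ i ∈ β, ∀ x, x ∉ P i → 0 < u i x := by
    intro i hi x hx
    refine lt_of_le_of_ne (hnn i x hx) fun h => (Finset.mem_filter.1 hi).2 (hTd i x ?_)
    rw [mpT_off _ _ hx, ← h]; simp
  have hun : α ∪ β = Finset.univ := Finset.filter_union_filter_not_eq _ _
  have hdis : Disjoint α β := Finset.disjoint_filter_filter_not _ _ _
  rcases α.eq_empty_or_nonempty with hαe | hαne
  · left
    intro x hx i
    refine hpos i ?_ x (hQi x hx i)
    rw [hαe, Finset.empty_union] at hun
    rw [hun]; exact Finset.mem_univ i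
  · rcases β.eq_empty_or_nonempty with hβe | hβne
    · right
      have hall : ∀ i, ∀ x, x ∉ P i ∧ u i x = 0 := by
        intro i
        rw [hβe, Finset.union_empty] at hun
        have : i ∈ α := by rw [hun]; exact Finset.mem_univ i
        exact (Finset.mem_filter.1 this).2
      refine ⟨fun i x => (hall i x).2, ?_⟩
      rw [Set.eq_empty_iff_forall_notMem]
      intro x hx
      obtain ⟨i, hi⟩ := Set.mem_iUnion.1 hx
      exact (hall i x).1 hi
    · exfalso
      obtain ⟨i, hi, j, hj, x, hx, hne0⟩ := h_coupled α β hαne hβne hdis hun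
      have hij : i ≠ j := fun h => (Finset.disjoint_left.1 hdis hi) (h ▸ hj)
      have hcpos : 0 < c i j x := lt_of_le_of_ne (h_coop i j hij x hx) (Ne.symm hne0)
      have hz := (Finset.mem_filter.1 hi).2
      have h1 := hL i x hx
      have h2 : u i = fun _ => 0 := funext fun y => (hz y).2
      have h3 : 0 < ∑ l, c i l x * u l x := by
        refine Finset.sum_pos' (fun l _ => ?_) ⟨j, Finset.mem_univ _, mul_pos hcpos (hpos j hj x (hQi x hx j))⟩
        by_cases h : i = l
        · rw [← h, (hz x).2, mul_zero]
        · exact mul_nonneg (h_coop i l h x hx) (hnn l x (hQi x hx l))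
      have h4 : mpL X (u i) x = 0 := by rw [h2, mpL_const]
      linarith [hf_nonpos i x hx]
end
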